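/- Let $W$ be a primitive $\omega$-Stone space, that is, a second countable, locally compact, Hausdorff, totally disconnected space such that every compact open set is a finite disjoint union of PI sets. Here, for a compact open set $A$, $(A)$ denotes the Boolean ring of compact open subsets of $A$, and $A$ is PI if for every compact open $B\subseteq A$ either $(B)\cong(A)$ or $(A\setminus B)\cong(A)$. A PO system is a set with a transitive antisymmetric relation $<$; write $p\le q$ for $p<q$ or $p=q$. A morphism $\alpha:Q\to P$ of PO systems is a map with $\alpha(\{r: r>q\})=\{p: p>\alpha(q)\}$ for all $q\in Q$. A PO system is simple if every morphism from it to a PO system is injective, and the simple image $s(Q)$ is the (unique up to isomorphism) simple PO system admitting a surjective morphism from $Q$. For a PO system $P$, a $P$-partition of $W$ is a family $\mathscr X=\{X_p\}_{p\in P}$ of pairwise disjoint nonempty subsets of $W$ such that, with $X=\bigcup_p X_p$, one has $X_p'\cap X=\bigcup_{q<p}X_q$ for all $p$ (where $'$ denotes the derived set). Put $T_{\mathscr X}(A)=\{p: A\cap X_p\neq\emptyset\}$. A compact open set $A$ is $p$-trim if $T_{\mathscr X}(A)=\{q: q\ge p\}$ and, in case $p\not<p$, $|A\cap X_p|=1$;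 it is trim if it is $p$-trim for some $p$. The partition is trim if (T1) every point of $W$ has a neighbourhood base of trim sets; (T2) if a $p$-trim set exists, then every point with a neighbourhood base of $p$-trim sets lies in $X_p$; (T3) every point of $X_p$ has a $p$-trim neighbourhood, for every $p$. A $Q$-partition $\mathscr Y$ regularly refines a $P$-partition $\mathscr Z$ via $\alpha:Q\to P$ if both satisfy (T1), $Y_q\subseteq Z_{\alpha(q)}$ for all $q\in Q$, and $p\in\alpha(T_{\mathscr Y}(A))$ whenever $A$ is $p$-trim for $\mathscr Z$. The structure diagram $\mathscr S(W)$ is the PO system of isomorphism classes $[A]$ of the rings $(A)$ for nonempty PI compact open sets $A$, with $[A]<[B]$ iff $(A)\times(B)\cong(A)$. The canonical partition is $\mathscr X(W)=\{X_p\}_{p\in\mathscr S(W)}$, where $X_p$ is the set of points having a neighbourhood base of compact open sets of class $p$. Let $Q$ be a PO system and $\mathscr Y$ a trim $Q$-partition of $W$. Then there is a unique surjective morphism $\beta:Q\to\mathscr S(W)$, and $\mathscr Y$ regularly refines $\mathscr X(W)$ via $\beta$ (in particular $\mathscr X(W)$ is an $\mathscr S(W)$-partition of $W$ satisfying (T1)).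 Moreover $\mathscr S(W)$ is isomorphic to the simple image $s(Q)$ of $Q$. -/

import Mathlib

open Set Topology

universe u v w

/-- A PO system: a set with a transitive antisymmetric relation `<`. -/
structure POSystem (P : Type u) : Type u where
  lt : P → P → Prop
  lt_trans : ∀ {a b c}, lt a b → lt b c → lt a c
  lt_antisymm : ∀ {a b}, lt a b → lt b a → a = b

namespace POSystem

/-- `a ≤ b` iff `a < b` or `a = b`. -/
def le {P : Type u} (S : POSystem P) (a b : P) : Prop := S.lt a b ∨ a = b

/-- A morphism of PO systems: for each `q`, the image of `{r | r > q}` is `{p | p > α q}`. -/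
def IsMorphism {Q : Type u} {P : Type v} (SQ : POSystem Q) (SP : POSystem P) (α : Q → P) : Prop :=
  ∀ q : Q, α '' {r | SQ.lt q r} = {p | SP.lt (α q) p}

/-- An isomorphism of PO systems. -/
def IsIso {Q : Type u} {P : Type v} (SQ : POSystem Q) (SP : POSystem P) (β : Q → P) : Prop :=
  Function.Bijective β ∧ ∀ a b : Q, SQ.lt a b ↔ SP.lt (β a) (β b)

/-- A PO system is simple if every morphism from it to a PO system is injective. The universe of
the targets is no restriction: the image of a morphism out of `P` is in bijection with a quotient
of `P`. -/
def IsSimple {P : Type u} (S : POSystem P) : Prop :=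
  ∀ (R : Type u) (SR : POSystem R) (δ : P → R), IsMorphism S SR δ → Function.Injective δ

/-- `ST` is a simple image of `SQ`: it is simple and admits a surjective morphism from `SQ`. -/
def IsSimpleImage {Q : Type u} {T : Type v} (SQ : POSystem Q) (ST : POSystem T) : Prop :=
  IsSimple ST ∧ ∃ γ : Q → T, Function.Surjective γ ∧ IsMorphism SQ ST γ

end POSystem

section Partitions

variable {W : Type*} [TopologicalSpace W] {P : Type*} {Q : Type*}

/-- The type `T(A)` of a subset `A` with respect to a partition `X`. -/
def ptype (X : P → Set W) (A : Set W) : Set P := {p | (A ∩ X p).Nonempty}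

/-- A `P`-partition of `W`: pairwise disjoint nonempty sets `X p` such that
`(X p)' ∩ X = ⋃_{q < p} X q`, where `X = ⋃ q, X q`. -/
def IsPPartition (S : POSystem P) (X : P → Set W) : Prop :=
  (∀ p, (X p).Nonempty) ∧ (Pairwise fun p q => Disjoint (X p) (X q)) ∧
    ∀ p, derivedSet (X p) ∩ (⋃ q, X q) = ⋃ q ∈ {q : P | S.lt q p}, X q

/-- `A` is a `p`-trim set. -/
def IsTrimAt (S : POSystem P) (X : P → Set W) (A : Set W) (p : P) : Prop :=
  IsCompact A ∧ IsOpen A ∧ ptype X A = {q | S.le p q} ∧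
    (¬ S.lt p p → ∃! x, x ∈ A ∩ X p)

/-- `A` is a trim set. -/
def IsTrimSet (S : POSystem P) (X : P → Set W) (A : Set W) : Prop :=
  ∃ p, IsTrimAt S X A p

/-- `P̂`: the set of `p` for which some `p`-trim set exists. -/
def Phat (S : POSystem P) (X : P → Set W) : Set P := {p | ∃ A, IsTrimAt S X A p}

/-- Axiom T1: every point of `W` has a neighbourhood base of trim sets. -/
def HasTrimBases (S : POSystem P) (X : P → Set W) : Prop :=
  ∀ w : W, ∀ U ∈ 𝓝 w, ∃ A, IsTrimSet S X A ∧ w ∈ A ∧ A ⊆ U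

/-- Axiom T2: for `p ∈ P̂`, every point with a neighbourhood base of `p`-trim sets is in `X p`. -/
def IsFullPartition (S : POSystem P) (X : P → Set W) : Prop :=
  ∀ p ∈ Phat S X, ∀ w : W,
    (∀ U ∈ 𝓝 w, ∃ A, IsTrimAt S X A p ∧ w ∈ A ∧ A ⊆ U) → w ∈ X p

/-- Axiom T3: every point of each `X p` is clean, i.e. has a `p`-trim neighbourhood. -/
def AllClean (S : POSystem P) (X : P → Set W) : Prop :=
  ∀ p : P, ∀ w ∈ X p, ∃ A, IsTrimAt S X A p ∧ w ∈ A

/-- A trim `P`-partition. -/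
def IsTrimPartition (S : POSystem P) (X : P → Set W) : Prop :=
  IsPPartition S X ∧ HasTrimBases S X ∧ IsFullPartition S X ∧ AllClean S X

/-- `Y` regularly refines `Z` via `α`: `Y` is a `Q`-partition and `Z` a `P`-partition, both satisfy
T1, `Y q ⊆ Z (α q)` for all `q`, and `p ∈ α(T_Y(A))` for all `p ∈ P̂` and all `p`-trim sets `A`
of `Z`. -/
def RegRefines (SQ : POSystem Q) (SP : POSystem P) (Y : Q → Set W) (Z : P → Set W)
    (α : Q → P) : Prop :=
  (IsPPartition SQ Y ∧ HasTrimBases SQ Y) ∧ (IsPPartition SP Z ∧ HasTrimBases SP Z) ∧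
    (∀ q, Y q ⊆ Z (α q)) ∧
    ∀ p ∈ Phat SP Z, ∀ A : Set W, IsTrimAt SP Z A p → p ∈ α '' ptype Y A

end Partitions

section Primitive

/-- The ideal `(A)` of the Boolean ring of compact open sets: the compact open subsets of `A`. -/
def coIdeal {W : Type u} [TopologicalSpace W] (A : Set W) : Set (Set W) :=
  {C | IsCompact C ∧ IsOpen C ∧ C ⊆ A}

/-- `(A) ≅ (B)`. For Boolean rings, ring isomorphisms and order isomorphisms are the same maps. -/
def IdealIso {W : Type u} [TopologicalSpace W] (A B : Set W) : Prop :=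
  Nonempty (↥(coIdeal A) ≃o ↥(coIdeal B))

/-- `(A) × (B) ≅ (A)`; the order of a product of Boolean rings is the componentwise one. -/
def ProdIdealIso {W : Type u} [TopologicalSpace W] (A B : Set W) : Prop :=
  Nonempty ((↥(coIdeal A) × ↥(coIdeal B)) ≃o ↥(coIdeal A))

/-- `A` is a pseudo-indecomposable (PI) element of the ring of compact open sets. -/
def IsPISet {W : Type u} [TopologicalSpace W] (A : Set W) : Prop :=
  IsCompact A ∧ IsOpen A ∧ ∀ B : Set W, IsCompact B → IsOpen B → B ⊆ A →
    IdealIso B A ∨ IdealIso (A \ B) A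

/-- `W` is primitive: every compact open set is a finite disjoint union of PI sets. -/
def PrimitiveSpace (W : Type u) [TopologicalSpace W] : Prop :=
  ∀ A : Set W, IsCompact A → IsOpen A →
    ∃ (n : ℕ) (F : Fin n → Set W), (∀ i, IsPISet (F i)) ∧
      (Pairwise fun i j => Disjoint (F i) (F j)) ∧ A = ⋃ i, F i

/-- The nonzero PI elements of the ring of compact open sets of `W`. -/
abbrev PISets (W : Type u) [TopologicalSpace W] : Type u :=
  {A : Set W // IsPISet A ∧ A.Nonempty}

/-- Nonzero PI sets up to isomorphism of their ideals. -/
def piIsoSetoid (W : Type u) [TopologicalSpace W] : Setoid (PISets W) where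
  r A B := IdealIso A.1 B.1
  iseqv := ⟨fun _ => ⟨OrderIso.refl _⟩,
    fun h => h.elim fun e => ⟨e.symm⟩,
    fun h1 h2 => h1.elim fun e => h2.elim fun f => ⟨e.trans f⟩⟩

/-- The underlying set of the structure diagram `𝒮(W)`: isomorphism classes of the ideals `(A)`
for nonzero PI elements `A`. -/
def SDiagram (W : Type u) [TopologicalSpace W] : Type u := Quotient (piIsoSetoid W)

/-- The class `[A]` in `𝒮(W)`. -/
def SDiagram.mk {W : Type u} [TopologicalSpace W] (A : PISets W) : SDiagram W :=
  Quotient.mk (piIsoSetoid W) A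

/-- The relation on `𝒮(W)`: `[A] < [B]` iff `(A) × (B) ≅ (A)`. -/
def SDiagram.Lt {W : Type u} [TopologicalSpace W] (x y : SDiagram W) : Prop :=
  ∃ A B : PISets W, x = SDiagram.mk A ∧ y = SDiagram.mk B ∧ ProdIdealIso A.1 B.1

theorem SDiagram.mk_eq_mk {W : Type u} [TopologicalSpace W] {A B : PISets W} :
    SDiagram.mk A = SDiagram.mk B ↔ IdealIso A.1 B.1 :=
  ⟨fun h => Quotient.exact h, fun h => Quotient.sound h⟩

/-- The product of two order isomorphisms. -/
def prodOrderIso {α β γ δ : Type*} [LE α] [LE β] [LE γ] [LE δ] (e : α ≃o β) (f : γ ≃o δ) :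
    α × γ ≃o β × δ where
  toEquiv := Equiv.prodCongr e.toEquiv f.toEquiv
  map_rel_iff' := by
    rintro ⟨a, c⟩ ⟨a', c'⟩
    simp [Prod.le_def]

/-- The relation on `𝒮(W)` does not depend on the representatives. -/
theorem SDiagram.lt_mk_mk {W : Type u} [TopologicalSpace W] {A B : PISets W} :
    SDiagram.Lt (SDiagram.mk A) (SDiagram.mk B) ↔ ProdIdealIso A.1 B.1 := by
  refine ⟨?_, fun h => ⟨A, B, rfl, rfl, h⟩⟩
  rintro ⟨A', B', hA, hB, ⟨e⟩⟩
  obtain ⟨a⟩ := SDiagram.mk_eq_mk.1 hA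
  obtain ⟨b⟩ := SDiagram.mk_eq_mk.1 hB
  exact ⟨((prodOrderIso a b).trans e).trans a.symm⟩

/-- The structure diagram `𝒮(W)` as a PO system. -/
def structureDiagram (W : Type u) [TopologicalSpace W] : POSystem (SDiagram W) where
  lt := SDiagram.Lt
  lt_trans := by
    rintro ⟨A⟩ ⟨B⟩ ⟨C⟩ h1 h2
    obtain ⟨e⟩ := SDiagram.lt_mk_mk.1 h1
    obtain ⟨f⟩ := SDiagram.lt_mk_mk.1 h2
    refine SDiagram.lt_mk_mk.2 ⟨?_⟩
    exact (((prodOrderIso e.symm (OrderIso.refl _)).trans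
      (OrderIso.prodAssoc _ _ _)).trans
      (prodOrderIso (OrderIso.refl _) f)).trans e
  lt_antisymm := by
    rintro ⟨A⟩ ⟨B⟩ h1 h2
    obtain ⟨e⟩ := SDiagram.lt_mk_mk.1 h1
    obtain ⟨f⟩ := SDiagram.lt_mk_mk.1 h2
    exact SDiagram.mk_eq_mk.2 ⟨(e.symm.trans OrderIso.prodComm).trans f⟩

/-- The block `X_p` of the canonical partition `𝒳(W)`: the points having a neighbourhood base
of compact open sets of class `p`. -/
def canonicalBlock {W : Type u} [TopologicalSpace W] (p : SDiagram W) : Set W :=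
  {w | ∀ U ∈ 𝓝 w, ∃ A : PISets W, SDiagram.mk A = p ∧ w ∈ A.1 ∧ A.1 ⊆ U}

end Primitive

/-! ### Isomorphisms between ideals of compact open sets -/

section CompactOpen

variable {W : Type u} [TopologicalSpace W]

/-- `A` is compact and open. -/
def IsKO (A : Set W) : Prop := IsCompact A ∧ IsOpen A

theorem IsKO.empty : IsKO (∅ : Set W) := ⟨isCompact_empty, isOpen_empty⟩

theorem IsKO.union {A B : Set W} (hA : IsKO A) (hB : IsKO B) : IsKO (A ∪ B) :=
  ⟨hA.1.union hB.1, hA.2.union hB.2⟩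

theorem IsKO.inter [T2Space W] {A B : Set W} (hA : IsKO A) (hB : IsKO B) : IsKO (A ∩ B) :=
  ⟨hA.1.inter hB.1, hA.2.inter hB.2⟩

theorem IsKO.diff [T2Space W] {A B : Set W} (hA : IsKO A) (hB : IsKO B) : IsKO (A \ B) :=
  ⟨hA.1.diff hB.2, hA.2.sdiff hB.1.isClosed⟩

theorem mem_coIdeal {A C : Set W} : C ∈ coIdeal A ↔ IsKO C ∧ C ⊆ A :=
  and_assoc.symm

theorem IdealIso.refl (A : Set W) : IdealIso A A := ⟨OrderIso.refl _⟩

theorem IdealIso.symm {A B : Set W} (h : IdealIso A B) : IdealIso B A :=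
  h.elim fun e => ⟨e.symm⟩

theorem IdealIso.trans {A B C : Set W} (h : IdealIso A B) (h' : IdealIso B C) : IdealIso A C :=
  h.elim fun e => h'.elim fun f => ⟨e.trans f⟩

theorem IdealIso.nonempty {A B : Set W} (h : IdealIso A B) (hA : IsKO A) (hne : A.Nonempty) :
    B.Nonempty := by
  obtain ⟨e⟩ := h
  by_contra hB
  rw [not_nonempty_iff_eq_empty] at hB
  subst hB
  have h1 : e ⟨A, mem_coIdeal.2 ⟨hA, Subset.rfl⟩⟩
      = e ⟨∅, mem_coIdeal.2 ⟨IsKO.empty, empty_subset _⟩⟩ := by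
    apply Subtype.ext
    rw [subset_empty_iff.1 (mem_coIdeal.1 (e _).2).2, subset_empty_iff.1 (mem_coIdeal.1 (e _).2).2]
  have h2 := congrArg Subtype.val (e.injective h1)
  exact hne.ne_empty h2

/-- The ideal of a disjoint union is the product of the ideals. -/
theorem exists_orderIso_union [T2Space W] {A B : Set W} (hA : IsKO A) (hB : IsKO B)
    (hd : Disjoint A B) :
    Nonempty (↥(coIdeal (A ∪ B)) ≃o (↥(coIdeal A) × ↥(coIdeal B))) := by
  have hAB : ∀ x, x ∈ A → x ∈ B → False := fun x h h' => disjoint_left.1 hd h h'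
  refine ⟨{
    toFun := fun C => (⟨C.1 ∩ A, mem_coIdeal.2
        ⟨(mem_coIdeal.1 C.2).1.inter hA, inter_subset_right⟩⟩,
      ⟨C.1 ∩ B, mem_coIdeal.2 ⟨(mem_coIdeal.1 C.2).1.inter hB, inter_subset_right⟩⟩)
    invFun := fun D => ⟨D.1.1 ∪ D.2.1, mem_coIdeal.2
      ⟨(mem_coIdeal.1 D.1.2).1.union (mem_coIdeal.1 D.2.2).1,
        union_subset_union (mem_coIdeal.1 D.1.2).2 (mem_coIdeal.1 D.2.2).2⟩⟩
    left_inv := ?_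
    right_inv := ?_
    map_rel_iff' := ?_ }⟩
  · rintro ⟨C, hC⟩
    apply Subtype.ext
    change C ∩ A ∪ C ∩ B = C
    rw [← inter_union_distrib_left, inter_eq_left]
    exact (mem_coIdeal.1 hC).2
  · rintro ⟨⟨D, hD⟩, ⟨E, hE⟩⟩
    have hD' := (mem_coIdeal.1 hD).2
    have hE' := (mem_coIdeal.1 hE).2
    refine Prod.ext (Subtype.ext ?_) (Subtype.ext ?_)
    · change (D ∪ E) ∩ A = D
      ext x
      exact ⟨fun h => h.1.elim id fun h' => (hAB x h.2 (hE' h')).elim, fun h => ⟨.inl h, hD' h⟩⟩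
    · change (D ∪ E) ∩ B = E
      ext x
      exact ⟨fun h => h.1.elim (fun h' => (hAB x (hD' h') h.2).elim) id, fun h => ⟨.inr h, hE' h⟩⟩
  · rintro ⟨C, hC⟩ ⟨D, hD⟩
    have hC' := (mem_coIdeal.1 hC).2
    change (C ∩ A ⊆ D ∩ A ∧ C ∩ B ⊆ D ∩ B) ↔ C ⊆ D
    refine ⟨fun h x hx => ?_, fun h => ⟨inter_subset_inter_left _ h, inter_subset_inter_left _ h⟩⟩
    rcases hC' hx with h' | h'
    · exact (h.1 ⟨hx, h'⟩).1
    · exact (h.2 ⟨hx, h'⟩).1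

/-- The part of `C` that corresponds to the first factor of a product representation. -/
theorem idealIso_image_fst {A B C : Set W} (hA : IsKO A)
    (e : (↥(coIdeal A) × ↥(coIdeal B)) ≃o ↥(coIdeal C)) :
    IdealIso (e (⟨A, mem_coIdeal.2 ⟨hA, Subset.rfl⟩⟩,
      ⟨∅, mem_coIdeal.2 ⟨IsKO.empty, empty_subset _⟩⟩)).1 A := by
  set oB : ↥(coIdeal B) := ⟨∅, mem_coIdeal.2 ⟨IsKO.empty, empty_subset _⟩⟩
  set tA : ↥(coIdeal A) := ⟨A, mem_coIdeal.2 ⟨hA, Subset.rfl⟩⟩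
  have hoB : ∀ x, oB ≤ x := fun x => empty_subset x.1
  have htA : ∀ x, x ≤ tA := fun x => (mem_coIdeal.1 x.2).2
  have kA := mem_coIdeal.1 (e (tA, oB)).2
  let ι : ↥(coIdeal (e (tA, oB)).1) → ↥(coIdeal C) := fun X => ⟨X.1, mem_coIdeal.2
    ⟨(mem_coIdeal.1 X.2).1, (mem_coIdeal.1 X.2).2.trans kA.2⟩⟩
  have hι : ∀ X, ((e.symm (ι X)).1, oB) = e.symm (ι X) := by
    intro X
    have h : e.symm (ι X) ≤ (tA, oB) := e.symm_apply_le.2 (mem_coIdeal.1 X.2).2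
    exact Prod.ext rfl (le_antisymm (hoB _) h.2)
  refine ⟨{
    toFun := fun X => (e.symm (ι X)).1
    invFun := fun D => ⟨(e (D, oB)).1, mem_coIdeal.2 ⟨(mem_coIdeal.1 (e (D, oB)).2).1,
      e.le_iff_le.2 (⟨htA D, le_rfl⟩ : (D, oB) ≤ (tA, oB))⟩⟩
    left_inv := fun X => Subtype.ext ?_
    right_inv := fun D => ?_
    map_rel_iff' := fun {X X'} => ?_ }⟩
  · change (e ((e.symm (ι X)).1, oB)).1 = X.1
    rw [hι, e.apply_symm_apply]
  · change (e.symm (e (D, oB))).1 = D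
    rw [e.symm_apply_apply]
  · have h : e.symm (ι X) ≤ e.symm (ι X') ↔ X ≤ X' := e.symm.le_iff_le
    rw [← h, ← hι X, ← hι X']
    exact ⟨fun h => ⟨h, le_rfl⟩, fun h => h.1⟩

/-- A representation of the ideal of `C` as a product splits `C`. -/
theorem exists_split_of_prod_orderIso [T2Space W] {A B C : Set W} (hA : IsKO A) (hB : IsKO B)
    (hC : IsKO C) (e : (↥(coIdeal A) × ↥(coIdeal B)) ≃o ↥(coIdeal C)) :
    ∃ A' B' : Set W, IsKO A' ∧ IsKO B' ∧ Disjoint A' B' ∧ A' ∪ B' = C ∧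
      IdealIso A' A ∧ IdealIso B' B := by
  let oA : ↥(coIdeal A) := ⟨∅, mem_coIdeal.2 ⟨IsKO.empty, empty_subset _⟩⟩
  let oB : ↥(coIdeal B) := ⟨∅, mem_coIdeal.2 ⟨IsKO.empty, empty_subset _⟩⟩
  let tA : ↥(coIdeal A) := ⟨A, mem_coIdeal.2 ⟨hA, Subset.rfl⟩⟩
  let tB : ↥(coIdeal B) := ⟨B, mem_coIdeal.2 ⟨hB, Subset.rfl⟩⟩
  have hoA : ∀ x, oA ≤ x := fun x => empty_subset x.1
  have hoB : ∀ x, oB ≤ x := fun x => empty_subset x.1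
  have htA : ∀ x, x ≤ tA := fun x => (mem_coIdeal.1 x.2).2
  have htB : ∀ x, x ≤ tB := fun x => (mem_coIdeal.1 x.2).2
  have kA := mem_coIdeal.1 (e (tA, oB)).2
  have kB := mem_coIdeal.1 (e (oA, tB)).2
  refine ⟨(e (tA, oB)).1, (e (oA, tB)).1, kA.1, kB.1, ?_, ?_, idealIso_image_fst hA e,
    idealIso_image_fst hB (OrderIso.prodComm.trans e)⟩
  · let x : ↥(coIdeal C) := ⟨(e (tA, oB)).1 ∩ (e (oA, tB)).1,
      mem_coIdeal.2 ⟨kA.1.inter kB.1, inter_subset_left.trans kA.2⟩⟩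
    have h1 : e.symm x ≤ (tA, oB) := e.symm_apply_le.2 (inter_subset_left : x.1 ⊆ _)
    have h2 : e.symm x ≤ (oA, tB) := e.symm_apply_le.2 (inter_subset_right : x.1 ⊆ _)
    let o : ↥(coIdeal C) := ⟨∅, mem_coIdeal.2 ⟨IsKO.empty, empty_subset _⟩⟩
    have h3 : e.symm x ≤ e.symm o :=
      ⟨le_trans (b := oA) h2.1 (hoA _), le_trans (b := oB) h1.2 (hoB _)⟩
    have h4 : x ≤ o := e.symm.le_iff_le.1 h3
    exact disjoint_iff_inter_eq_empty.2 (subset_empty_iff.1 h4)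
  · let x : ↥(coIdeal C) := ⟨(e (tA, oB)).1 ∪ (e (oA, tB)).1,
      mem_coIdeal.2 ⟨kA.1.union kB.1, union_subset kA.2 kB.2⟩⟩
    have h1 : (tA, oB) ≤ e.symm x := e.le_symm_apply.2 (subset_union_left : _ ⊆ x.1)
    have h2 : (oA, tB) ≤ e.symm x := e.le_symm_apply.2 (subset_union_right : _ ⊆ x.1)
    let t : ↥(coIdeal C) := ⟨C, mem_coIdeal.2 ⟨hC, Subset.rfl⟩⟩
    have h3 : e.symm t ≤ e.symm x :=
      ⟨le_trans (htA _) h1.1, le_trans (htB _) h2.2⟩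
    have h4 : t ≤ x := e.symm.le_iff_le.1 h3
    exact Subset.antisymm (union_subset kA.2 kB.2) h4

theorem prodIdealIso_of_disjoint [T2Space W] {A B A' B' : Set W} (hA' : IsKO A') (hB' : IsKO B')
    (hd : Disjoint A' B') (hA : IdealIso A' A) (hB : IdealIso B' B) (hU : IdealIso (A' ∪ B') A) :
    ProdIdealIso A B := by
  obtain ⟨a⟩ := hA
  obtain ⟨b⟩ := hB
  obtain ⟨c⟩ := hU
  obtain ⟨f⟩ := exists_orderIso_union hA' hB' hd
  exact ⟨((prodOrderIso a.symm b.symm).trans f.symm).trans c⟩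

/-- An isomorphism of ideals carries a splitting of one set to a splitting of the other. -/
theorem IdealIso.exists_split [T2Space W] {B C D : Set W} (h : IdealIso (C ∪ D) B) (hB : IsKO B)
    (hC : IsKO C) (hD : IsKO D) (hd : Disjoint C D) :
    ∃ C' D' : Set W, IsKO C' ∧ IsKO D' ∧ Disjoint C' D' ∧ C' ∪ D' = B ∧
      IdealIso C' C ∧ IdealIso D' D := by
  obtain ⟨e⟩ := h
  obtain ⟨f⟩ := exists_orderIso_union hC hD hd
  exact exists_split_of_prod_orderIso hC hD hB (f.symm.trans e)

theorem IsPISet.isKO {A : Set W} (h : IsPISet A) : IsKO A := ⟨h.1, h.2.1⟩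

theorem IsPISet.congr [T2Space W] {A B : Set W} (hA : IsPISet A) (h : IdealIso A B)
    (hB : IsKO B) : IsPISet B := by
  refine ⟨hB.1, hB.2, fun C hC hC' hCB => ?_⟩
  have hCk : IsKO C := ⟨hC, hC'⟩
  have hU : C ∪ B \ C = B := union_sdiff_cancel hCB
  obtain ⟨C', D', kC, kD, hd, hU', i, j⟩ := IdealIso.exists_split
    (hU.symm ▸ h.symm : IdealIso (C ∪ B \ C) A) hA.isKO hCk (hB.diff hCk) disjoint_sdiff_right
  have hD : A \ C' = D' := by rw [← hU', union_sdiff_left, hd.symm.sdiff_eq_left]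
  rcases hA.2.2 C' kC.1 kC.2 (hU' ▸ subset_union_left) with k | k
  · exact .inl ((i.symm.trans k).trans h)
  · exact .inr ((j.symm.trans (hD ▸ k)).trans h)

theorem IsPISet.idealIso_or [T2Space W] {A B C : Set W} (hA : IsPISet A) (hB : IsKO B)
    (hd : Disjoint B C) (hU : B ∪ C = A) : IdealIso B A ∨ IdealIso C A := by
  have hC : A \ B = C := by rw [← hU, union_sdiff_left, hd.symm.sdiff_eq_left]
  exact hC ▸ hA.2.2 B hB.1 hB.2 (hU ▸ subset_union_left)

theorem countable_coIdeal [SecondCountableTopology W] (A : Set W) : (coIdeal A).Countable := by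
  obtain ⟨b, hbc, -, hb⟩ := TopologicalSpace.exists_countable_basis W
  refine ((Set.countable_ofPred_finite_subset hbc).image sUnion).mono ?_
  rintro C ⟨hC, hC', -⟩
  obtain ⟨s, hsf, hs⟩ := eq_finite_iUnion_of_isTopologicalBasis_of_isCompact_open
    (fun i : b => i.1) (by simpa using hb) C hC hC'
  refine ⟨(fun i : b => i.1) '' s, ⟨hsf.image _, ?_⟩, ?_⟩
  · rintro _ ⟨i, -, rfl⟩
    exact i.2
  · rw [hs, sUnion_image]

end CompactOpen

/-! ### Back and forth -/

section BackForth

/-- The finite joins of members of `s`. -/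
def finsetJoins {α : Type*} [BooleanAlgebra α] (s : Finset α) : Set α :=
  {y | ∃ u ⊆ s, u.sup id = y}

/-- Cutting every member `x` of a disjoint family into `f x` and `x \ f x`. -/
theorem exists_refinement {α : Type*} [BooleanAlgebra α] (s : Finset α)
    (hs : (s : Set α).PairwiseDisjoint id) (f : α → α) (hf : ∀ x ∈ s, f x ≤ x) :
    ∃ t : Finset α, (t : Set α).PairwiseDisjoint id ∧ t.sup id = s.sup id ∧
      (∀ y ∈ t, ∃ x ∈ s, y = f x ∨ y = x \ f x) ∧ finsetJoins s ⊆ finsetJoins t ∧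
      s.sup f ∈ finsetJoins t := by
  classical
  let g : Finset α → Finset α := fun u => u.image f ∪ u.image (fun x => x \ f x)
  have hg : ∀ u ⊆ s, (g u).sup id = u.sup id := by
    intro u hu
    simp only [g, Finset.sup_union, Finset.sup_image, Function.id_comp]
    rw [← Finset.sup_sup]
    exact Finset.sup_congr rfl fun x hx => sup_sdiff_cancel_right (hf x (hu hx))
  have hmem : ∀ y ∈ g s, ∃ x ∈ s, y = f x ∨ y = x \ f x := by
    intro y hy
    simp only [g, Finset.mem_union, Finset.mem_image] at hy
    rcases hy with ⟨x, hx, rfl⟩ | ⟨x, hx, rfl⟩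
    · exact ⟨x, hx, .inl rfl⟩
    · exact ⟨x, hx, .inr rfl⟩
  refine ⟨g s, ?_, hg s (Finset.Subset.refl _), hmem, ?_, ?_⟩
  · intro y hy z hz hyz
    obtain ⟨x, hx, hxy⟩ := hmem y hy
    obtain ⟨x', hx', hxz⟩ := hmem z hz
    by_cases h : x = x'
    · subst h
      rcases hxy with rfl | rfl <;> rcases hxz with rfl | rfl
      · exact (hyz rfl).elim
      · exact disjoint_sdiff_self_right
      · exact disjoint_sdiff_self_left
      · exact (hyz rfl).elim
    · refine Disjoint.mono ?_ ?_ (hs hx hx' h)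
      · rcases hxy with rfl | rfl
        · exact hf x hx
        · exact sdiff_le
      · rcases hxz with rfl | rfl
        · exact hf x' hx'
        · exact sdiff_le
  · rintro _ ⟨u, hu, rfl⟩
    exact ⟨g u, Finset.union_subset_union (Finset.image_subset_image hu)
      (Finset.image_subset_image hu), hg u hu⟩
  · exact ⟨s.image f, Finset.subset_union_left, by rw [Finset.sup_image]; rfl⟩

variable {W : Type u}

/-- A finite approximation to an isomorphism between the ideals of `A` and `B`: disjoint cells
with join `(A, B)` and related coordinates. -/
structure BackForthState (R : Set W → Set W → Prop) (A B : Set W) where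
  cells : Finset (Set W × Set W)
  rel : ∀ x ∈ cells, R x.1 x.2
  disj : (cells : Set (Set W × Set W)).PairwiseDisjoint id
  sup_eq : cells.sup id = (A, B)

instance (R : Set W → Set W → Prop) (A B : Set W) : Preorder (BackForthState R A B) :=
  Preorder.lift fun s => finsetJoins s.cells

theorem BackForthState.le_iff {R : Set W → Set W → Prop} {A B : Set W}
    {s : BackForthState R A B} {y z : Set W × Set W} (hbot : ∀ {C D}, R C D → (C = ∅ ↔ D = ∅))
    (hy : y ∈ finsetJoins s.cells) (hz : z ∈ finsetJoins s.cells) : y.1 ⊆ z.1 ↔ y.2 ⊆ z.2 := by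
  obtain ⟨u, hu, rfl⟩ := hy
  obtain ⟨v, hv, rfl⟩ := hz
  have key : ∀ x ∈ u, x ∉ v → Disjoint x (v.sup id) := fun x hx hxv =>
    Finset.disjoint_sup_right.2 fun z hz =>
      s.disj (hu hx) (hv hz) fun h => hxv (h ▸ hz)
  have hfst : ∀ u : Finset (Set W × Set W), (u.sup id).1 = u.sup Prod.fst := fun u =>
    (Finset.apply_sup_eq_sup_comp Prod.fst (fun _ _ => rfl) rfl)
  have hsnd : ∀ u : Finset (Set W × Set W), (u.sup id).2 = u.sup Prod.snd := fun u =>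
    (Finset.apply_sup_eq_sup_comp Prod.snd (fun _ _ => rfl) rfl)
  constructor
  · intro h
    rw [hsnd u]
    refine Finset.sup_le fun x hx => ?_
    by_cases hxv : x ∈ v
    · exact (Prod.le_def.1 (Finset.le_sup (f := id) hxv)).2
    · have h1 : x.1 ≤ (v.sup id).1 := le_trans (Prod.le_def.1 (Finset.le_sup (f := id) hx)).1 h
      have h2 : x.1 = ∅ := (Prod.disjoint_iff.1 (key x hx hxv)).1.eq_bot_of_le h1
      rw [(hbot (s.rel x (hu hx))).1 h2]
      exact empty_subset _
  · intro h
    rw [hfst u]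
    refine Finset.sup_le fun x hx => ?_
    by_cases hxv : x ∈ v
    · exact (Prod.le_def.1 (Finset.le_sup (f := id) hxv)).1
    · have h1 : x.2 ≤ (v.sup id).2 := le_trans (Prod.le_def.1 (Finset.le_sup (f := id) hx)).2 h
      have h2 : x.2 = ∅ := (Prod.disjoint_iff.1 (key x hx hxv)).2.eq_bot_of_le h1
      rw [(hbot (s.rel x (hu hx))).2 h2]
      exact empty_subset _

theorem BackForthState.isKO [TopologicalSpace W] {R : Set W → Set W → Prop} {A B : Set W}
    (hKO : ∀ {C D}, R C D → IsKO C ∧ IsKO D)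
    {s : BackForthState R A B} {y : Set W × Set W} (hy : y ∈ finsetJoins s.cells) :
    y.1 ∈ coIdeal A ∧ y.2 ∈ coIdeal B := by
  obtain ⟨u, hu, rfl⟩ := hy
  have h1 : u.sup id ≤ (A, B) := s.sup_eq ▸ Finset.sup_mono hu
  have h2 : IsKO (u.sup id).1 ∧ IsKO (u.sup id).2 :=
    Finset.sup_induction (p := fun y : Set W × Set W => IsKO y.1 ∧ IsKO y.2)
      ⟨IsKO.empty, IsKO.empty⟩ (fun a ha b hb => ⟨ha.1.union hb.1, ha.2.union hb.2⟩)
      fun x hx => hKO (s.rel x (hu hx))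
  exact ⟨mem_coIdeal.2 ⟨h2.1, h1.1⟩, mem_coIdeal.2 ⟨h2.2, h1.2⟩⟩

theorem BackForthState.exists_extension {R : Set W → Set W → Prop} {A B : Set W}
    (s : BackForthState R A B) (f : Set W × Set W → Set W × Set W)
    (hf : ∀ x ∈ s.cells, f x ≤ x ∧ R (f x).1 (f x).2 ∧ R (x.1 \ (f x).1) (x.2 \ (f x).2)) :
    ∃ t : BackForthState R A B, s ≤ t ∧ s.cells.sup f ∈ finsetJoins t.cells := by
  obtain ⟨t, hd, hsup, hmem, hle, hin⟩ :=
    exists_refinement s.cells s.disj f fun x hx => (hf x hx).1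
  refine ⟨⟨t, ?_, hd, hsup.trans s.sup_eq⟩, hle, hin⟩
  intro y hy
  obtain ⟨x, hx, rfl | rfl⟩ := hmem y hy
  · exact (hf x hx).2.1
  · exact (hf x hx).2.2

/-- Two sets related by a symmetric back-and-forth relation have isomorphic ideals. -/
theorem idealIso_of_backForth [TopologicalSpace W] [SecondCountableTopology W] [T2Space W]
    {R : Set W → Set W → Prop}
    (hKO : ∀ {C D}, R C D → IsKO C ∧ IsKO D) (hsymm : ∀ {C D}, R C D → R D C)
    (hbot : ∀ {C D}, R C D → C = ∅ → D = ∅)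
    (hsplit : ∀ {C D C'}, R C D → IsKO C' → C' ⊆ C →
      ∃ D' ⊆ D, R C' D' ∧ R (C \ C') (D \ D'))
    {A B : Set W} (hAB : R A B) : IdealIso A B := by
  classical
  have hbot' : ∀ {C D}, R C D → (C = ∅ ↔ D = ∅) := fun h => ⟨hbot h, hbot (hsymm h)⟩
  have forth : ∀ (C : coIdeal A) (s : BackForthState R A B),
      ∃ t, (∃ D, (C.1, D) ∈ finsetJoins t.cells) ∧ s ≤ t := by
    intro C s
    have hC := mem_coIdeal.1 C.2
    have : ∀ x : Set W × Set W, ∃ D, x ∈ s.cells →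
        D ⊆ x.2 ∧ R (x.1 ∩ C.1) D ∧ R (x.1 \ (x.1 ∩ C.1)) (x.2 \ D) := by
      intro x
      by_cases hx : x ∈ s.cells
      · obtain ⟨D, h⟩ := hsplit (s.rel x hx) ((hKO (s.rel x hx)).1.inter hC.1) inter_subset_left
        exact ⟨D, fun _ => h⟩
      · exact ⟨∅, fun h => (hx h).elim⟩
    choose g hg using this
    obtain ⟨t, hst, ht⟩ := s.exists_extension (fun x => (x.1 ∩ C.1, g x))
      fun x hx => ⟨⟨inter_subset_left, (hg x hx).1⟩, (hg x hx).2⟩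
    refine ⟨t, ⟨(s.cells.sup fun x => (x.1 ∩ C.1, g x)).2, ?_⟩, hst⟩
    · convert ht using 1
      refine Prod.ext ?_ rfl
      have h1 : (s.cells.sup fun x => (x.1 ∩ C.1, g x)).1 = s.cells.sup (fun x => x.1 ⊓ C.1) :=
        Finset.apply_sup_eq_sup_comp Prod.fst (fun _ _ => rfl) rfl
      have h2 : (s.cells.sup id).1 = s.cells.sup Prod.fst :=
        Finset.apply_sup_eq_sup_comp Prod.fst (fun _ _ => rfl) rfl
      change C.1 = (s.cells.sup fun x => (x.1 ∩ C.1, g x)).1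
      rw [h1, ← Finset.sup_inf_distrib_right, show s.cells.sup (fun x => x.1) = A by
        rw [← h2, s.sup_eq]]
      exact (inter_eq_right.2 hC.2).symm
  have back : ∀ (D : coIdeal B) (s : BackForthState R A B),
      ∃ t, (∃ C, (C, D.1) ∈ finsetJoins t.cells) ∧ s ≤ t := by
    intro D s
    have hD := mem_coIdeal.1 D.2
    have : ∀ x : Set W × Set W, ∃ C, x ∈ s.cells →
        C ⊆ x.1 ∧ R C (x.2 ∩ D.1) ∧ R (x.1 \ C) (x.2 \ (x.2 ∩ D.1)) := by
      intro x
      by_cases hx : x ∈ s.cells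
      · obtain ⟨C, h, h', h''⟩ := hsplit (hsymm (s.rel x hx))
          ((hKO (s.rel x hx)).2.inter hD.1) inter_subset_left
        exact ⟨C, fun _ => ⟨h, hsymm h', hsymm h''⟩⟩
      · exact ⟨∅, fun h => (hx h).elim⟩
    choose g hg using this
    obtain ⟨t, hst, ht⟩ := s.exists_extension (fun x => (g x, x.2 ∩ D.1))
      fun x hx => ⟨⟨(hg x hx).1, inter_subset_left⟩, (hg x hx).2⟩
    refine ⟨t, ⟨(s.cells.sup fun x => (g x, x.2 ∩ D.1)).1, ?_⟩, hst⟩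
    · convert ht using 1
      refine Prod.ext rfl ?_
      have h1 : (s.cells.sup fun x => (g x, x.2 ∩ D.1)).2 = s.cells.sup (fun x => x.2 ⊓ D.1) :=
        Finset.apply_sup_eq_sup_comp Prod.snd (fun _ _ => rfl) rfl
      have h2 : (s.cells.sup id).2 = s.cells.sup Prod.snd :=
        Finset.apply_sup_eq_sup_comp Prod.snd (fun _ _ => rfl) rfl
      change D.1 = (s.cells.sup fun x => (g x, x.2 ∩ D.1)).2
      rw [h1, ← Finset.sup_inf_distrib_right, show s.cells.sup (fun x => x.2) = B by
        rw [← h2, s.sup_eq]]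
      exact (inter_eq_right.2 hD.2).symm
  have := (countable_coIdeal A).to_subtype
  have := (countable_coIdeal B).to_subtype
  let _ : Encodable (coIdeal A ⊕ coIdeal B) := Encodable.ofCountable _
  let start : BackForthState R A B := ⟨{(A, B)}, by simpa using hAB, by simp, by simp⟩
  let 𝒟 : coIdeal A ⊕ coIdeal B → Order.Cofinal (BackForthState R A B) := Sum.elim
    (fun C => ⟨{t | ∃ D, (C.1, D) ∈ finsetJoins t.cells}, fun s => forth C s⟩)
    (fun D => ⟨{t | ∃ C, (C, D.1) ∈ finsetJoins t.cells}, fun s => back D s⟩)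
  let I := Order.idealOfCofinals start 𝒟
  let G : Set W → Set W → Prop := fun C D => ∃ s ∈ I, (C, D) ∈ finsetJoins s.cells
  have hGle : ∀ {C D C' D'}, G C D → G C' D' → (C ⊆ C' ↔ D ⊆ D') := by
    rintro C D C' D' ⟨s, hs, h⟩ ⟨s', hs', h'⟩
    obtain ⟨t, -, hst, hst'⟩ := I.directed s hs s' hs'
    exact BackForthState.le_iff hbot' (hst h) (hst' h')
  have hGA : ∀ C : coIdeal A, ∃ D : coIdeal B, G C.1 D.1 := by
    intro C
    obtain ⟨s, ⟨D, hD⟩, hs⟩ := Order.cofinal_meets_idealOfCofinals start 𝒟 (.inl C)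
    exact ⟨⟨D, (BackForthState.isKO hKO hD).2⟩, s, hs, hD⟩
  have hGB : ∀ D : coIdeal B, ∃ C : coIdeal A, G C.1 D.1 := by
    intro D
    obtain ⟨s, ⟨C, hC⟩, hs⟩ := Order.cofinal_meets_idealOfCofinals start 𝒟 (.inr D)
    exact ⟨⟨C, (BackForthState.isKO hKO hC).1⟩, s, hs, hC⟩
  choose φ hφ using hGA
  choose ψ hψ using hGB
  refine ⟨{ toFun := φ, invFun := ψ, left_inv := fun C => Subtype.ext ?_,
            right_inv := fun D => Subtype.ext ?_,
            map_rel_iff' := fun {C C'} => (hGle (hφ C) (hφ C')).symm }⟩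
  · exact Subset.antisymm ((hGle (hψ _) (hφ _)).2 Subset.rfl) ((hGle (hφ _) (hψ _)).2 Subset.rfl)
  · exact Subset.antisymm ((hGle (hφ _) (hψ _)).1 Subset.rfl) ((hGle (hψ _) (hφ _)).1 Subset.rfl)

end BackForth

/-! ### Decompositions into trim sets -/

theorem POSystem.lt_of_le_of_lt {P : Type u} (S : POSystem P) {a b c : P} (h : S.le a b)
    (h' : S.lt b c) : S.lt a c :=
  h.elim (fun k => S.lt_trans k h') fun e => e ▸ h'

theorem POSystem.le_antisymm {P : Type u} (S : POSystem P) {a b : P} (h : S.le a b)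
    (h' : S.le b a) : a = b :=
  h.elim (fun k => h'.elim (S.lt_antisymm k) Eq.symm) id

theorem ptype_mono {W : Type u} {P : Type v} {X : P → Set W} {A B : Set W} (h : A ⊆ B) :
    ptype X A ⊆ ptype X B :=
  fun _ hp => hp.mono (inter_subset_inter_left _ h)

section TrimSets

variable {W : Type u} [TopologicalSpace W] {P : Type v} {S : POSystem P} {X : P → Set W}

/-- The properties of a family of blocks that determine trim sets up to isomorphism. -/
structure IsCleanFamily (S : POSystem P) (X : P → Set W) : Prop where
  acc : ∀ {p r}, S.lt p r → X p ⊆ derivedSet (X r)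
  bases : HasTrimBases S X
  clean : AllClean S X

theorem IsTrimPartition.isCleanFamily (h : IsTrimPartition S X) : IsCleanFamily S X where
  acc {p r} hpr x hx := by
    have : x ∈ ⋃ q ∈ {q : P | S.lt q r}, X q := mem_biUnion hpr hx
    rw [← h.1.2.2 r] at this
    exact this.1
  bases := h.2.1
  clean := h.2.2.2

theorem IsTrimAt.isKO {A : Set W} {p : P} (h : IsTrimAt S X A p) : IsKO A := ⟨h.1, h.2.1⟩

theorem IsTrimAt.mem_ptype {A : Set W} {p r : P} (h : IsTrimAt S X A p) :
    r ∈ ptype X A ↔ S.le p r := by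
  rw [h.2.2.1]; rfl

theorem IsTrimAt.exists_mem {A : Set W} {p : P} (h : IsTrimAt S X A p) : ∃ y ∈ A, y ∈ X p :=
  h.mem_ptype.2 (.inr rfl)

theorem IsTrimAt.nonempty {A : Set W} {p : P} (h : IsTrimAt S X A p) : A.Nonempty :=
  h.exists_mem.imp fun _ hy => hy.1

theorem IsTrimAt.lt_self {A : Set W} {p : P} (h : IsTrimAt S X A p) {x y : W} (hx : x ∈ A)
    (hx' : x ∈ X p) (hy : y ∈ A) (hy' : y ∈ X p) (hxy : x ≠ y) : S.lt p p :=
  by_contra fun hp => hxy ((h.2.2.2 hp).unique ⟨hx, hx'⟩ ⟨hy, hy'⟩)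

theorem IsCleanFamily.exists_ne (hX : IsCleanFamily S X) {p r : P} (hpr : S.lt p r) {y : W}
    (hy : y ∈ X p) {A : Set W} (hA : IsOpen A) (hyA : y ∈ A) : ∃ z ∈ A, z ∈ X r ∧ z ≠ y := by
  obtain ⟨z, ⟨hz, hz'⟩, hne⟩ :=
    accPt_iff_nhds.1 (mem_derivedSet.1 (hX.acc hpr hy)) A (hA.mem_nhds hyA)
  exact ⟨z, hz, hz', hne⟩

theorem IsCleanFamily.exists_isKO (hX : IsCleanFamily S X) {w : W} {U : Set W} (hU : U ∈ 𝓝 w) :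
    ∃ A, IsKO A ∧ w ∈ A ∧ A ⊆ U := by
  obtain ⟨A, ⟨p, hA⟩, hw, hAU⟩ := hX.bases w U hU
  exact ⟨A, hA.isKO, hw, hAU⟩

theorem IsTrimAt.mono (hX : IsCleanFamily S X) {A B : Set W} {p : P} (h : IsTrimAt S X A p)
    (hB : IsKO B) (hBA : B ⊆ A) {y : W} (hy : y ∈ B) (hyp : y ∈ X p) : IsTrimAt S X B p := by
  refine ⟨hB.1, hB.2, Subset.antisymm (h.2.2.1 ▸ ptype_mono hBA) ?_, fun hp => ?_⟩
  · rintro r (hr | rfl)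
    · obtain ⟨z, hz, hzr, -⟩ := hX.exists_ne hr hyp hB.2 hy
      exact ⟨z, hz, hzr⟩
    · exact ⟨y, hy, hyp⟩
  · exact ⟨y, ⟨hy, hyp⟩, fun z hz => (h.2.2.2 hp).unique ⟨hBA hz.1, hz.2⟩ ⟨hBA hy, hyp⟩⟩

/-- Points of `X p` have arbitrarily small `p`-trim neighbourhoods. -/
theorem IsCleanFamily.exists_trim_subset [T2Space W] (hX : IsCleanFamily S X) {p : P} {w : W}
    (hw : w ∈ X p) {U : Set W} (hU : U ∈ 𝓝 w) : ∃ A, IsTrimAt S X A p ∧ w ∈ A ∧ A ⊆ U := by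
  obtain ⟨A, hA, hwA⟩ := hX.clean p w hw
  obtain ⟨B, hB, hwB, hBU⟩ := hX.exists_isKO hU
  exact ⟨A ∩ B, hA.mono hX (hA.isKO.inter hB) inter_subset_left ⟨hwA, hwB⟩ hw, ⟨hwA, hwB⟩,
    inter_subset_right.trans hBU⟩

/-- `A` is a disjoint union of trim sets of the types listed in `l`. -/
inductive TrimSum (S : POSystem P) (X : P → Set W) : List P → Set W → Prop
  | nil : TrimSum S X [] ∅
  | cons {p : P} {l : List P} {A B : Set W} : IsTrimAt S X A p → TrimSum S X l B →
      Disjoint A B → TrimSum S X (p :: l) (A ∪ B)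

theorem trimSum_nil {A : Set W} : TrimSum S X [] A ↔ A = ∅ := by
  constructor
  · rintro ⟨⟩
    rfl
  · rintro rfl
    exact .nil

theorem trimSum_cons {p : P} {l : List P} {C : Set W} :
    TrimSum S X (p :: l) C ↔
      ∃ A B, IsTrimAt S X A p ∧ TrimSum S X l B ∧ Disjoint A B ∧ C = A ∪ B := by
  constructor
  · rintro (_ | ⟨hA, hB, hd⟩)
    exact ⟨_, _, hA, hB, hd, rfl⟩
  · rintro ⟨A, B, hA, hB, hd, rfl⟩
    exact .cons hA hB hd

theorem IsTrimAt.trimSum {A : Set W} {p : P} (h : IsTrimAt S X A p) : TrimSum S X [p] A :=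
  trimSum_cons.2 ⟨A, ∅, h, .nil, disjoint_empty _, (union_empty A).symm⟩

theorem TrimSum.isKO {l : List P} {A : Set W} (h : TrimSum S X l A) : IsKO A := by
  induction h with
  | nil => exact IsKO.empty
  | cons hA _ _ ih => exact hA.isKO.union ih

theorem TrimSum.append {l m : List P} {A B : Set W} (hA : TrimSum S X l A)
    (hB : TrimSum S X m B) (hd : Disjoint A B) : TrimSum S X (l ++ m) (A ∪ B) := by
  induction hA with
  | nil => simpa using hB
  | cons hA hA' hd' ih =>
    rw [union_assoc]
    exact .cons hA (ih (hd.mono_left subset_union_right))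
      (disjoint_union_right.2 ⟨hd', hd.mono_left subset_union_left⟩)

theorem TrimSum.exists_of_append {l m : List P} {C : Set W} (h : TrimSum S X (l ++ m) C) :
    ∃ A B, TrimSum S X l A ∧ TrimSum S X m B ∧ Disjoint A B ∧ C = A ∪ B := by
  induction l generalizing C with
  | nil => exact ⟨∅, C, .nil, h, empty_disjoint _, (empty_union C).symm⟩
  | cons p l ih =>
    obtain ⟨A, B, hA, hB, hd, rfl⟩ := trimSum_cons.1 h
    obtain ⟨A', B', hA', hB', hd', rfl⟩ := ih hB
    rw [disjoint_union_right] at hd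
    exact ⟨A ∪ A', B', .cons hA hA' hd.1, hB', disjoint_union_left.2 ⟨hd.2, hd'⟩,
      (union_assoc _ _ _).symm⟩

theorem TrimSum.perm {l m : List P} (hlm : l.Perm m) {A : Set W} (h : TrimSum S X l A) :
    TrimSum S X m A := by
  induction hlm generalizing A with
  | nil => exact h
  | cons p _ ih =>
    obtain ⟨A, B, hA, hB, hd, rfl⟩ := trimSum_cons.1 h
    exact .cons hA (ih hB) hd
  | swap p q l =>
    obtain ⟨A, _, hA, hBC, hd, rfl⟩ := trimSum_cons.1 h
    obtain ⟨B, C, hB, hC, hd', rfl⟩ := trimSum_cons.1 hBC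
    rw [disjoint_union_right] at hd
    rw [union_left_comm]
    exact .cons hB (.cons hA hC hd.2) (disjoint_union_right.2 ⟨hd.1.symm, hd'⟩)
  | trans _ _ ih1 ih2 => exact ih2 (ih1 h)

theorem TrimSum.mem_ptype {l : List P} {A : Set W} (h : TrimSum S X l A) {r : P} (hr : r ∈ l) :
    r ∈ ptype X A := by
  induction h with
  | nil => simp at hr
  | cons hA _ _ ih =>
    rcases List.mem_cons.1 hr with rfl | hr
    · exact ptype_mono subset_union_left (hA.mem_ptype.2 (.inr rfl))
    · exact ptype_mono subset_union_right (ih hr)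

theorem TrimSum.exists_le {l : List P} {A : Set W} (h : TrimSum S X l A) {r : P}
    (hr : r ∈ ptype X A) : ∃ p ∈ l, S.le p r := by
  induction h with
  | nil => obtain ⟨x, hx, -⟩ := hr; exact hx.elim
  | cons hA _ _ ih =>
    obtain ⟨x, hx | hx, hxr⟩ := hr
    · exact ⟨_, List.mem_cons_self, hA.mem_ptype.1 ⟨x, hx, hxr⟩⟩
    · obtain ⟨p, hp, h⟩ := ih ⟨x, hx, hxr⟩
      exact ⟨p, List.mem_cons_of_mem _ hp, h⟩

/-- A set with types above a type present in a trim sum can be absorbed. -/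
theorem TrimSum.absorb {l : List P} {E F : Set W} (h : TrimSum S X l E) (hF : IsKO F)
    (hd : Disjoint E F) {p : P} (hp : p ∈ ptype X E) (hpF : ∀ r ∈ ptype X F, S.lt p r) :
    TrimSum S X l (E ∪ F) := by
  induction h with
  | nil => obtain ⟨x, hx, -⟩ := hp; exact hx.elim
  | @cons p₀ l A B hA hB hAB ih =>
    rw [disjoint_union_left] at hd
    obtain ⟨x, hx | hx, hxp⟩ := hp
    · have hle : S.le p₀ p := hA.mem_ptype.1 ⟨x, hx, hxp⟩
      rw [union_right_comm]
      refine .cons ⟨(hA.isKO.union hF).1, (hA.isKO.union hF).2, ?_, fun hp₀ => ?_⟩ hB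
        (disjoint_union_left.2 ⟨hAB, hd.2.symm⟩)
      · refine Subset.antisymm ?_ (hA.2.2.1 ▸ ptype_mono subset_union_left)
        rintro r ⟨y, hy | hy, hyr⟩
        · exact hA.mem_ptype.1 ⟨y, hy, hyr⟩
        · exact .inl (S.lt_of_le_of_lt hle (hpF r ⟨y, hy, hyr⟩))
      · obtain ⟨y, hy, huniq⟩ := hA.2.2.2 hp₀
        refine ⟨y, ⟨.inl hy.1, hy.2⟩, ?_⟩
        rintro z ⟨hz | hz, hz'⟩
        · exact huniq z ⟨hz, hz'⟩
        · exact (hp₀ (S.lt_of_le_of_lt hle (hpF p₀ ⟨z, hz, hz'⟩))).elim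
    · rw [union_assoc]
      exact .cons hA (ih hd.2 ⟨x, hx, hxp⟩) (disjoint_union_right.2 ⟨hAB, hd.1⟩)

theorem TrimSum.exists_union_trim [T2Space W] (hX : IsCleanFamily S X) {l : List P} {E B : Set W}
    {p : P} (h : TrimSum S X l E) (hB : IsTrimAt S X B p) : ∃ m, TrimSum S X m (E ∪ B) := by
  have hk : IsKO (B \ E) := hB.isKO.diff h.isKO
  by_cases hp : p ∈ ptype X (B \ E)
  · obtain ⟨y, hy, hyp⟩ := hp
    refine ⟨p :: l, ?_⟩
    rw [union_comm, ← sdiff_union_self]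
    exact .cons (hB.mono hX hk sdiff_subset hy hyp) h disjoint_sdiff_left
  · refine ⟨l, ?_⟩
    rw [← union_sdiff_self]
    obtain ⟨y, hy, hyp⟩ := hB.exists_mem
    refine h.absorb hk disjoint_sdiff_right (p := p) ⟨y, ?_, hyp⟩ fun r hr => ?_
    · by_contra hyE
      exact hp ⟨y, ⟨hy, hyE⟩, hyp⟩
    · rcases hB.mem_ptype.1 (ptype_mono sdiff_subset hr) with h | rfl
      · exact h
      · exact (hp hr).elim

theorem TrimSum.exists_union [T2Space W] (hX : IsCleanFamily S X) {l m : List P} {E F : Set W}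
    (hE : TrimSum S X l E) (hF : TrimSum S X m F) : ∃ n, TrimSum S X n (E ∪ F) := by
  induction hF generalizing l E with
  | nil => exact ⟨l, by simpa using hE⟩
  | cons hA _ _ ih =>
    obtain ⟨n, hn⟩ := hE.exists_union_trim hX hA
    rw [← union_assoc]
    exact ih hn

/-- Every compact open set is a disjoint union of finitely many trim sets. -/
theorem IsCleanFamily.exists_trimSum [T2Space W] (hX : IsCleanFamily S X) {A : Set W}
    (hA : IsKO A) : ∃ l, TrimSum S X l A := by
  obtain ⟨E, hAE, hEA, l, hl⟩ := hA.1.induction_on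
    (p := fun s => ∃ E, s ⊆ E ∧ E ⊆ A ∧ ∃ l, TrimSum S X l E)
    ⟨∅, Subset.rfl, empty_subset _, [], .nil⟩
    (fun s t hst ⟨E, h, h'⟩ => ⟨E, hst.trans h, h'⟩)
    (by
      rintro s t ⟨E, hs, hEA, l, hl⟩ ⟨F, ht, hFA, m, hm⟩
      exact ⟨E ∪ F, union_subset_union hs ht, union_subset hEA hFA, hl.exists_union hX hm⟩)
    (by
      intro x hx
      obtain ⟨B, ⟨p, hB⟩, hxB, hBA⟩ := hX.bases x A (hA.2.mem_nhds hx)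
      exact ⟨B, mem_nhdsWithin_of_mem_nhds (hB.isKO.2.mem_nhds hxB), B, Subset.rfl, hBA, [p],
        hB.trimSum⟩)
  rw [Subset.antisymm hAE hEA]
  exact ⟨l, hl⟩

/-- Trim sets of types above `p` can be split off a `p`-trim set. -/
theorem IsTrimAt.trimSum_cons [T2Space W] (hX : IsCleanFamily S X) {p : P} {l : List P}
    (hl : ∀ r ∈ l, S.lt p r) {B : Set W} (hB : IsTrimAt S X B p) : TrimSum S X (p :: l) B := by
  induction l generalizing B with
  | nil => exact hB.trimSum
  | cons r l ih =>
    obtain ⟨y, hy, hyp⟩ := hB.exists_mem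
    obtain ⟨z, hz, hzr, hne⟩ := hX.exists_ne (hl r List.mem_cons_self) hyp hB.isKO.2 hy
    obtain ⟨E, hE, hzE, hEs⟩ := hX.exists_trim_subset hzr
      ((hB.isKO.2.sdiff (isClosed_singleton (x := y))).mem_nhds ⟨hz, hne⟩)
    have hyE : y ∈ B \ E := ⟨hy, fun h => (hEs h).2 rfl⟩
    have hBE := ih (fun r hr => hl r (List.mem_cons_of_mem _ hr))
      (hB.mono hX (hB.isKO.diff hE.isKO) sdiff_subset hyE hyp)
    refine TrimSum.perm (List.Perm.swap p r l) ?_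
    rw [← union_sdiff_cancel (hEs.trans sdiff_subset)]
    exact .cons hE hBE disjoint_sdiff_right

/-- Two `p`-trim sets decompose in the same way. -/
theorem TrimSum.of_trim [T2Space W] (hX : IsCleanFamily S X) {p : P} {l : List P} {A B : Set W}
    (hA : IsTrimAt S X A p) (hB : IsTrimAt S X B p) (h : TrimSum S X l A) : TrimSum S X l B := by
  classical
  have hle : ∀ r ∈ l, S.le p r := fun r hr => hA.mem_ptype.1 (h.mem_ptype hr)
  obtain ⟨r, hr, hrp⟩ := h.exists_le (hA.mem_ptype.2 (.inr rfl))
  obtain rfl := S.le_antisymm hrp (hle r hr)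
  have hperm := List.perm_cons_erase hr
  refine TrimSum.perm hperm.symm (hB.trimSum_cons hX fun s hs => ?_)
  rcases hle s (List.mem_of_mem_erase hs) with h' | rfl
  · exact h'
  · obtain ⟨A₀, B₀, hA₀, hB₀, hd, rfl⟩ := _root_.trimSum_cons.1 (h.perm hperm)
    obtain ⟨x, hx, hxr⟩ := hA₀.exists_mem
    obtain ⟨y, hy, hyr⟩ := hB₀.mem_ptype hs
    exact hA.lt_self (.inl hx) hxr (.inr hy) hyr fun e => disjoint_left.1 hd hx (e ▸ hy)

theorem TrimSum.exists_split [T2Space W] (hX : IsCleanFamily S X) {l : List P} {C D C' : Set W}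
    (hC : TrimSum S X l C) (hD : TrimSum S X l D) (hC' : IsKO C') (hCC : C' ⊆ C) :
    ∃ D' ⊆ D, (∃ m, TrimSum S X m C' ∧ TrimSum S X m D') ∧
      ∃ n, TrimSum S X n (C \ C') ∧ TrimSum S X n (D \ D') := by
  induction hC generalizing D C' with
  | nil =>
    obtain rfl := trimSum_nil.1 hD
    obtain rfl := subset_empty_iff.1 hCC
    exact ⟨∅, Subset.rfl, ⟨[], .nil, .nil⟩, [], by simpa using .nil, by simpa using .nil⟩
  | @cons p l A B hA hB hAB ih =>
    obtain ⟨A₂, B₂, hA₂, hB₂, hd₂, rfl⟩ := trimSum_cons.1 hD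
    obtain ⟨m₁, h₁⟩ := hX.exists_trimSum (hA.isKO.inter hC')
    obtain ⟨n₁, k₁⟩ := hX.exists_trimSum (hA.isKO.diff hC')
    have hA' : TrimSum S X (m₁ ++ n₁) A := by
      have := h₁.append k₁ (disjoint_sdiff_right.mono_left inter_subset_right)
      rwa [inter_union_sdiff] at this
    obtain ⟨E, F, hE, hF, hEF, rfl⟩ := (hA'.of_trim hX hA hA₂).exists_of_append
    obtain ⟨G, hG, ⟨m₂, h₂, h₂'⟩, n₂, k₂, k₂'⟩ :=
      ih hB₂ (hC'.inter hB.isKO) inter_subset_right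
    rw [disjoint_union_left] at hd₂
    refine ⟨E ∪ G, union_subset_union subset_union_left hG, ⟨m₁ ++ m₂, ?_, ?_⟩, n₁ ++ n₂, ?_, ?_⟩
    · convert h₁.append h₂ (hAB.mono inter_subset_left inter_subset_right) using 1
      rw [inter_comm A, ← inter_union_distrib_left, inter_eq_left.2 hCC]
    · exact hE.append h₂' (hd₂.1.mono_right hG)
    · convert k₁.append k₂ (hAB.mono sdiff_subset sdiff_subset) using 1
      ext x
      simp only [mem_sdiff, mem_union, mem_inter_iff]
      tauto
    · convert hF.append k₂' (hd₂.2.mono_right sdiff_subset) using 1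
      ext x
      have h1 := fun h : x ∈ E => disjoint_left.1 hEF h
      have h2 := fun h : x ∈ E => disjoint_left.1 hd₂.1 h
      have h3 := fun h : x ∈ F => fun h' : x ∈ G => disjoint_left.1 hd₂.2 h (hG h')
      simp only [mem_sdiff, mem_union]
      tauto

/-- Trim sets of the same type are isomorphic. -/
theorem IsTrimAt.idealIso [T2Space W] [SecondCountableTopology W] (hX : IsCleanFamily S X) {p : P}
    {A B : Set W} (hA : IsTrimAt S X A p) (hB : IsTrimAt S X B p) : IdealIso A B := by
  refine idealIso_of_backForth (R := fun C D => ∃ l, TrimSum S X l C ∧ TrimSum S X l D)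
    ?_ ?_ ?_ ?_ ⟨[p], hA.trimSum, hB.trimSum⟩
  · rintro C D ⟨l, hC, hD⟩
    exact ⟨hC.isKO, hD.isKO⟩
  · rintro C D ⟨l, hC, hD⟩
    exact ⟨l, hD, hC⟩
  · rintro C D ⟨l, hC, hD⟩ rfl
    cases l with
    | nil => exact trimSum_nil.1 hD
    | cons p l =>
      obtain ⟨x, hx, -⟩ := hC.mem_ptype List.mem_cons_self
      exact hx.elim
  · rintro C D C' ⟨l, hC, hD⟩ hC' hCC
    exact hC.exists_split hX hD hC' hCC

theorem IsTrimAt.isPISet [T2Space W] [SecondCountableTopology W] (hX : IsCleanFamily S X) {p : P}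
    {A : Set W} (hA : IsTrimAt S X A p) : IsPISet A := by
  refine ⟨hA.1, hA.2.1, fun B hB hB' hBA => ?_⟩
  have hBk : IsKO B := ⟨hB, hB'⟩
  obtain ⟨y, hy, hyp⟩ := hA.exists_mem
  by_cases hyB : y ∈ B
  · exact .inl ((hA.mono hX hBk hBA hyB hyp).idealIso hX hA)
  · exact .inr ((hA.mono hX (hA.isKO.diff hBk) sdiff_subset ⟨hy, hyB⟩ hyp).idealIso hX hA)

/-- A nonempty PI set is isomorphic to one of its trim subsets. -/
theorem IsPISet.exists_trim [T2Space W] (hX : IsCleanFamily S X) {A : Set W} (hA : IsPISet A)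
    (hne : A.Nonempty) : ∃ r, ∃ B ⊆ A, IsTrimAt S X B r ∧ IdealIso B A := by
  obtain ⟨l, hl⟩ := hX.exists_trimSum hA.isKO
  induction hl with
  | nil => exact hne.ne_empty rfl |>.elim
  | @cons p l C D hC hD hd ih =>
    rcases hA.idealIso_or hC.isKO hd rfl with h | h
    · exact ⟨p, C, subset_union_left, hC, h⟩
    · obtain ⟨r, B, hB, hBr, hBD⟩ := ih (hA.congr h.symm hD.isKO) (h.symm.nonempty hA.isKO hne)
      exact ⟨r, B, hB.trans subset_union_right, hBr, hBD.trans h⟩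

end TrimSets

/-! ### Bisimulations of PO systems -/

namespace POSystem

/-- A bisimulation: related elements have related strict upper bounds. -/
def IsBisimulation {P : Type u} (S : POSystem P) (E : P → P → Prop) : Prop :=
  ∀ a b, E a b → (∀ a', S.lt a a' → ∃ b', S.lt b b' ∧ E a' b') ∧
    ∀ b', S.lt b b' → ∃ a', S.lt a a' ∧ E a' b'

theorem IsMorphism.lt {Q : Type u} {P : Type v} {SQ : POSystem Q} {SP : POSystem P} {α : Q → P}
    (h : IsMorphism SQ SP α) {q r : Q} (hqr : SQ.lt q r) : SP.lt (α q) (α r) :=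
  (h q).le (mem_image_of_mem α hqr)

theorem IsMorphism.exists_lt {Q : Type u} {P : Type v} {SQ : POSystem Q} {SP : POSystem P}
    {α : Q → P} (h : IsMorphism SQ SP α) {q : Q} {p : P} (hp : SP.lt (α q) p) :
    ∃ r, SQ.lt q r ∧ α r = p :=
  (h q).ge hp

/-- The union of all bisimulations. -/
def Bisimilar {P : Type u} (S : POSystem P) (a b : P) : Prop :=
  ∃ E : P → P → Prop, S.IsBisimulation E ∧ E a b

theorem isBisimulation_bisimilar {P : Type u} (S : POSystem P) :
    S.IsBisimulation S.Bisimilar := by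
  rintro a b ⟨E, hE, h⟩
  refine ⟨fun a' ha => ?_, fun b' hb => ?_⟩
  · obtain ⟨b', hb, h'⟩ := (hE a b h).1 a' ha
    exact ⟨b', hb, E, hE, h'⟩
  · obtain ⟨a', ha, h'⟩ := (hE a b h).2 b' hb
    exact ⟨a', ha, E, hE, h'⟩

/-- Elements with bisimilar strict upper bounds are bisimilar. -/
theorem bisimilar_of_upper {P : Type u} (S : POSystem P) {a b : P}
    (h1 : ∀ a', S.lt a a' → ∃ b', S.lt b b' ∧ S.Bisimilar a' b')
    (h2 : ∀ b', S.lt b b' → ∃ a', S.lt a a' ∧ S.Bisimilar a' b') : S.Bisimilar a b := by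
  refine ⟨fun x y => S.Bisimilar x y ∨ x = a ∧ y = b, ?_, .inr ⟨rfl, rfl⟩⟩
  rintro x y (h | ⟨rfl, rfl⟩)
  · refine ⟨fun x' hx => ?_, fun y' hy => ?_⟩
    · obtain ⟨y', hy, h'⟩ := (S.isBisimulation_bisimilar x y h).1 x' hx
      exact ⟨y', hy, .inl h'⟩
    · obtain ⟨x', hx, h'⟩ := (S.isBisimulation_bisimilar x y h).2 y' hy
      exact ⟨x', hx, .inl h'⟩
  · refine ⟨fun x' hx => ?_, fun y' hy => ?_⟩
    · obtain ⟨y', hy, h'⟩ := h1 x' hx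
      exact ⟨y', hy, .inl h'⟩
    · obtain ⟨x', hx, h'⟩ := h2 y' hy
      exact ⟨x', hx, .inl h'⟩

theorem Bisimilar.refl {P : Type u} (S : POSystem P) (a : P) : S.Bisimilar a a :=
  ⟨Eq, by rintro a _ rfl; exact ⟨fun a' h => ⟨a', h, rfl⟩, fun a' h => ⟨a', h, rfl⟩⟩, rfl⟩

theorem Bisimilar.symm {P : Type u} {S : POSystem P} {a b : P} :
    S.Bisimilar a b → S.Bisimilar b a := by
  rintro ⟨E, hE, h⟩
  exact ⟨fun x y => E y x, fun x y h => ⟨(hE y x h).2, (hE y x h).1⟩, h⟩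

theorem Bisimilar.trans {P : Type u} {S : POSystem P} {a b c : P} :
    S.Bisimilar a b → S.Bisimilar b c → S.Bisimilar a c := by
  intro h1 h2
  refine ⟨fun x z => ∃ y, S.Bisimilar x y ∧ S.Bisimilar y z, ?_, b, h1, h2⟩
  rintro x z ⟨y, hxy, hyz⟩
  refine ⟨fun x' hx => ?_, fun z' hz => ?_⟩
  · obtain ⟨y', hy, h⟩ := (S.isBisimulation_bisimilar x y hxy).1 x' hx
    obtain ⟨z', hz, h'⟩ := (S.isBisimulation_bisimilar y z hyz).1 y' hy
    exact ⟨z', hz, y', h, h'⟩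
  · obtain ⟨y', hy, h⟩ := (S.isBisimulation_bisimilar y z hyz).2 z' hz
    obtain ⟨x', hx, h'⟩ := (S.isBisimulation_bisimilar x y hxy).2 y' hy
    exact ⟨x', hx, y', h', h⟩

/-- Bisimilarity as a setoid. -/
def bisimSetoid {P : Type u} (S : POSystem P) : Setoid P :=
  ⟨S.Bisimilar, Bisimilar.refl S, Bisimilar.symm, Bisimilar.trans⟩

/-- The order induced on bisimilarity classes. -/
def quotLt {P : Type u} (S : POSystem P) (x y : Quotient S.bisimSetoid) : Prop :=
  ∃ a b, Quotient.mk S.bisimSetoid a = x ∧ Quotient.mk S.bisimSetoid b = y ∧ S.lt a b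

theorem quotLt_mk {P : Type u} (S : POSystem P) {a : P} {y : Quotient S.bisimSetoid}
    (h : S.quotLt (Quotient.mk S.bisimSetoid a) y) :
    ∃ b, S.lt a b ∧ Quotient.mk S.bisimSetoid b = y := by
  obtain ⟨a', b', ha, rfl, h⟩ := h
  obtain ⟨b, hb, hbb⟩ := (S.isBisimulation_bisimilar a' a (Quotient.exact ha)).1 b' h
  exact ⟨b, hb, Quotient.sound hbb.symm⟩

/-- The quotient of a PO system by bisimilarity. -/
def bisimQuotient {P : Type u} (S : POSystem P) : POSystem (Quotient S.bisimSetoid) where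
  lt := S.quotLt
  lt_trans := by
    rintro ⟨a⟩ y z h1 h2
    obtain ⟨b, hab, rfl⟩ := S.quotLt_mk h1
    obtain ⟨c, hbc, rfl⟩ := S.quotLt_mk h2
    exact ⟨a, c, rfl, rfl, S.lt_trans hab hbc⟩
  lt_antisymm := by
    rintro ⟨a⟩ ⟨b⟩ h1 h2
    obtain ⟨b', hab, hb⟩ := S.quotLt_mk h1
    obtain ⟨a', hba, ha⟩ := S.quotLt_mk h2
    refine Quotient.sound (S.bisimilar_of_upper (fun x hx => ?_) fun x hx => ?_)
    · obtain ⟨y, hy, hxy⟩ := (S.isBisimulation_bisimilar a' a (Quotient.exact ha)).2 x hx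
      exact ⟨y, S.lt_trans hba hy, hxy.symm⟩
    · obtain ⟨y, hy, hxy⟩ := (S.isBisimulation_bisimilar b' b (Quotient.exact hb)).2 x hx
      exact ⟨y, S.lt_trans hab hy, hxy⟩

theorem isMorphism_bisimQuotient {P : Type u} (S : POSystem P) :
    IsMorphism S S.bisimQuotient (Quotient.mk S.bisimSetoid) := by
  intro a
  ext y
  constructor
  · rintro ⟨b, hb, rfl⟩
    exact ⟨a, b, rfl, rfl, hb⟩
  · intro h
    obtain ⟨b, hb, rfl⟩ := S.quotLt_mk h
    exact ⟨b, hb, rfl⟩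

/-- Bisimulations of a simple PO system are contained in equality. -/
theorem IsSimple.eq_of_bisimulation {P : Type u} {S : POSystem P} (hS : S.IsSimple)
    {E : P → P → Prop} (hE : S.IsBisimulation E) {a b : P} (h : E a b) : a = b :=
  hS _ S.bisimQuotient _ S.isMorphism_bisimQuotient (Quotient.sound ⟨E, hE, h⟩)

/-- Morphisms into a simple PO system are unique. -/
theorem IsSimple.morphism_unique {Q : Type u} {P : Type v} {SQ : POSystem Q} {S : POSystem P}
    (hS : S.IsSimple) {α β : Q → P} (hα : IsMorphism SQ S α) (hβ : IsMorphism SQ S β) :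
    α = β := by
  funext q
  refine hS.eq_of_bisimulation (E := fun a b => ∃ q, α q = a ∧ β q = b) ?_ ⟨q, rfl, rfl⟩
  rintro _ _ ⟨q, rfl, rfl⟩
  refine ⟨fun a' h => ?_, fun b' h => ?_⟩
  · obtain ⟨r, hr, rfl⟩ := hα.exists_lt h
    exact ⟨β r, hβ.lt hr, r, rfl, rfl⟩
  · obtain ⟨r, hr, rfl⟩ := hβ.exists_lt h
    exact ⟨α r, hα.lt hr, r, rfl, rfl⟩

/-- The kernel of a morphism is contained in that of any morphism to a simple PO system. -/
theorem IsSimple.eq_of_eq {Q : Type u} {P : Type v} {T : Type w} {SQ : POSystem Q}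
    {SP : POSystem P} {ST : POSystem T} (hT : ST.IsSimple) {α : Q → P} {γ : Q → T}
    (hα : IsMorphism SQ SP α) (hγ : IsMorphism SQ ST γ) {q r : Q} (h : α q = α r) :
    γ q = γ r := by
  refine hT.eq_of_bisimulation (E := fun a b => ∃ q r, α q = α r ∧ γ q = a ∧ γ r = b) ?_
    ⟨q, r, h, rfl, rfl⟩
  rintro _ _ ⟨q, r, h, rfl, rfl⟩
  refine ⟨fun a' ha => ?_, fun b' hb => ?_⟩
  · obtain ⟨q', hq, rfl⟩ := hγ.exists_lt ha
    obtain ⟨r', hr, hr'⟩ := hα.exists_lt (h ▸ hα.lt hq)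
    exact ⟨γ r', hγ.lt hr, q', r', hr'.symm, rfl, rfl⟩
  · obtain ⟨r', hr, rfl⟩ := hγ.exists_lt hb
    obtain ⟨q', hq, hq'⟩ := hα.exists_lt (h.symm ▸ hα.lt hr)
    exact ⟨γ q', hγ.lt hq, q', r', hq', rfl, rfl⟩

/-- Any two simple images of a PO system are isomorphic. -/
theorem IsSimpleImage.exists_isIso {Q : Type u} {P : Type v} {T : Type w} {SQ : POSystem Q}
    {SP : POSystem P} {ST : POSystem T} (hP : IsSimpleImage SQ SP) (hT : IsSimpleImage SQ ST) :
    ∃ φ : P → T, IsIso SP ST φ := by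
  obtain ⟨hP, α, hαs, hα⟩ := hP
  obtain ⟨hT, γ, hγs, hγ⟩ := hT
  choose σ hσ using hαs
  have key : ∀ q, γ (σ (α q)) = γ q := fun q => hT.eq_of_eq hα hγ (hσ _)
  refine ⟨fun p => γ (σ p), ⟨fun p p' h => ?_, fun t => ?_⟩, fun a b => ⟨fun h => ?_, fun h => ?_⟩⟩
  · rw [← hσ p, ← hσ p']
    exact hP.eq_of_eq hγ hα h
  · obtain ⟨q, rfl⟩ := hγs t
    exact ⟨α q, key q⟩
  · rw [← hσ a] at h
    obtain ⟨r, hr, rfl⟩ := hα.exists_lt h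
    change ST.lt (γ (σ a)) (γ (σ (α r)))
    rw [key]
    exact hγ.lt hr
  · obtain ⟨r, hr, hr'⟩ := hγ.exists_lt h
    have h1 := hα.lt hr
    rwa [hP.eq_of_eq hγ hα hr', hσ, hσ] at h1

end POSystem

/-! ### Coarsening along a morphism -/

section Coarsening

variable {W : Type u} [TopologicalSpace W] {Q : Type v} {R : Type w} {SQ : POSystem Q}
  {SR : POSystem R} {Y : Q → Set W} {γ : Q → R}

/-- The union of the blocks of `Y` over the fibre of `γ` at `r`. -/
def coarsen {W : Type u} {Q : Type v} {R : Type w} (Y : Q → Set W) (γ : Q → R) (r : R) : Set W :=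
  {x | ∃ q, γ q = r ∧ x ∈ Y q}

theorem IsTrimAt.coarsen (hγ : POSystem.IsMorphism SQ SR γ) {A : Set W} {q : Q}
    (hA : IsTrimAt SQ Y A q) : IsTrimAt SR (coarsen Y γ) A (γ q) := by
  refine ⟨hA.1, hA.2.1, ?_, fun hq => ?_⟩
  · ext r
    constructor
    · rintro ⟨x, hx, q', rfl, hxq⟩
      exact (hA.mem_ptype.1 ⟨x, hx, hxq⟩).imp hγ.lt (congrArg γ)
    · rintro (h | rfl)
      · obtain ⟨q', hq', rfl⟩ := hγ.exists_lt h
        obtain ⟨x, hx, hxq⟩ := hA.mem_ptype.2 (.inl hq')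
        exact ⟨x, hx, q', rfl, hxq⟩
      · obtain ⟨x, hx, hxq⟩ := hA.exists_mem
        exact ⟨x, hx, q, rfl, hxq⟩
  · obtain ⟨y, hy, huniq⟩ := hA.2.2.2 fun h => hq (hγ.lt h)
    refine ⟨y, ⟨hy.1, q, rfl, hy.2⟩, ?_⟩
    rintro z ⟨hz, q', hq', hzq⟩
    rcases hA.mem_ptype.1 ⟨z, hz, hzq⟩ with h | rfl
    · have := hγ.lt h
      rw [hq'] at this
      exact (hq this).elim
    · exact huniq z ⟨hz, hzq⟩

theorem IsCleanFamily.coarsen (hY : IsCleanFamily SQ Y) (hγ : POSystem.IsMorphism SQ SR γ) :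
    IsCleanFamily SR (coarsen Y γ) where
  acc {p r} hpr := by
    rintro x ⟨q, rfl, hx⟩
    obtain ⟨q', hq', rfl⟩ := hγ.exists_lt hpr
    have hsub : Y q' ⊆ {x | ∃ q, γ q = γ q' ∧ x ∈ Y q} := fun y hy => ⟨q', rfl, hy⟩
    exact derivedSet_mono _ _ hsub (hY.acc hq' hx)
  bases w U hU := by
    obtain ⟨A, ⟨q, hA⟩, h⟩ := hY.bases w U hU
    exact ⟨A, ⟨γ q, hA.coarsen hγ⟩, h⟩
  clean := by
    rintro _ w ⟨q, rfl, hw⟩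
    obtain ⟨A, hA, hwA⟩ := hY.clean q w hw
    exact ⟨A, hA.coarsen hγ, hwA⟩

end Coarsening

/-! ### Classes of PI sets -/

section Classes

variable {W : Type u} [TopologicalSpace W]

/-- `A` is a nonempty PI set of class `p`. -/
def IsOfClass (A : Set W) (p : SDiagram W) : Prop :=
  ∃ h : IsPISet A ∧ A.Nonempty, SDiagram.mk ⟨A, h⟩ = p

theorem mem_canonicalBlock {p : SDiagram W} {w : W} :
    w ∈ canonicalBlock p ↔ ∀ U ∈ 𝓝 w, ∃ A, IsOfClass A p ∧ w ∈ A ∧ A ⊆ U :=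
  forall₂_congr fun _ _ => ⟨fun ⟨A, h, h'⟩ => ⟨A.1, ⟨A.2, h⟩, h'⟩,
    fun ⟨A, ⟨hA, h⟩, h'⟩ => ⟨⟨A, hA⟩, h, h'⟩⟩

theorem exists_isOfClass (p : SDiagram W) : ∃ A, IsOfClass A p := by
  obtain ⟨A⟩ := p
  exact ⟨A.1, A.2, rfl⟩

variable {A B A' B' : Set W} {p q : SDiagram W}

theorem IsOfClass.isPISet (h : IsOfClass A p) : IsPISet A := h.1.1

theorem IsOfClass.isKO (h : IsOfClass A p) : IsKO A := h.isPISet.isKO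

theorem IsOfClass.nonempty (h : IsOfClass A p) : A.Nonempty := h.1.2

theorem IsOfClass.eq_iff (hA : IsOfClass A p) (hB : IsOfClass B q) : p = q ↔ IdealIso A B := by
  obtain ⟨hA, rfl⟩ := hA
  obtain ⟨hB, rfl⟩ := hB
  exact SDiagram.mk_eq_mk

theorem IsOfClass.congr [T2Space W] (hA : IsOfClass A p) (h : IdealIso A B) (hB : IsKO B) :
    IsOfClass B p := by
  have hB' : IsOfClass B (SDiagram.mk ⟨B, hA.isPISet.congr h hB, h.nonempty hA.isKO hA.nonempty⟩) :=
    ⟨_, rfl⟩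
  rwa [← (hA.eq_iff hB').2 h] at hB'

theorem IsOfClass.lt_iff (hA : IsOfClass A p) (hB : IsOfClass B q) :
    (structureDiagram W).lt p q ↔ ProdIdealIso A B := by
  obtain ⟨hA, rfl⟩ := hA
  obtain ⟨hB, rfl⟩ := hB
  exact SDiagram.lt_mk_mk

theorem IsOfClass.lt_of_disjoint [T2Space W] (hA : IsOfClass A p) (hB : IsOfClass B q)
    (hd : Disjoint A B) (hU : IsOfClass (A ∪ B) p) : (structureDiagram W).lt p q :=
  (hA.lt_iff hB).2 (prodIdealIso_of_disjoint hA.isKO hB.isKO hd (.refl _) (.refl _)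
    ((hU.eq_iff hA).1 rfl))

theorem IsOfClass.exists_split [T2Space W] (hA : IsOfClass A p)
    (h : (structureDiagram W).lt p q) :
    ∃ A' B', IsOfClass A' p ∧ IsOfClass B' q ∧ Disjoint A' B' ∧ A' ∪ B' = A := by
  obtain ⟨B, hB⟩ := exists_isOfClass q
  obtain ⟨e⟩ := (hA.lt_iff hB).1 h
  obtain ⟨A', B', kA, kB, hd, hU, i, j⟩ := exists_split_of_prod_orderIso hA.isKO hB.isKO hA.isKO e
  exact ⟨A', B', hA.congr i.symm kA, hB.congr j.symm kB, hd, hU⟩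

theorem IsOfClass.le_of_subset [T2Space W] (hA : IsOfClass A p) (hB : IsOfClass B q)
    (h : B ⊆ A) : (structureDiagram W).le p q := by
  rcases hA.isPISet.2.2 B hB.isKO.1 hB.isKO.2 h with i | i
  · exact .inr ((hA.eq_iff hB).2 i.symm)
  · refine .inl ((hA.congr i.symm (hA.isKO.diff hB.isKO)).lt_of_disjoint hB disjoint_sdiff_left ?_)
    rwa [sdiff_union_of_subset h]

theorem canonicalBlock_disjoint [T2Space W] (hpq : p ≠ q) :
    Disjoint (canonicalBlock p) (canonicalBlock q) := by
  refine disjoint_left.2 fun w hp hq => ?_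
  rw [mem_canonicalBlock] at hp hq
  obtain ⟨A, hA, hwA, -⟩ := hp univ Filter.univ_mem
  obtain ⟨B, hB, hwB, hBA⟩ := hq A (hA.isKO.2.mem_nhds hwA)
  obtain ⟨C, hC, hwC, hCB⟩ := hp B (hB.isKO.2.mem_nhds hwB)
  exact hpq ((structureDiagram W).le_antisymm (hA.le_of_subset hB hBA) (hB.le_of_subset hC hCB))

theorem IdealIso.exists_disjoint_subsets [T2Space W] {A₀ : Set W} (h : IdealIso A A₀)
    (hA : IsKO A) (hA₀ : IsKO A₀) (hB : IsKO B) (hB' : IsKO B') (hBA : B ⊆ A) (hBA' : B' ⊆ A)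
    (hd : Disjoint B B') :
    ∃ C ⊆ A₀, ∃ C' ⊆ A₀, IsKO C ∧ IsKO C' ∧ Disjoint C C' ∧ IdealIso C B ∧ IdealIso C' B' := by
  rw [← union_sdiff_cancel hBA] at h
  obtain ⟨C, D, hC, hD, hCD, rfl, i, j⟩ :=
    h.exists_split hA₀ hB (hA.diff hB) disjoint_sdiff_right
  rw [← union_sdiff_cancel (subset_sdiff.2 ⟨hBA', hd.symm⟩)] at j
  obtain ⟨C', E, hC', -, -, rfl, i', -⟩ :=
    j.symm.exists_split hD hB' ((hA.diff hB).diff hB') disjoint_sdiff_right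
  exact ⟨C, subset_union_left, C', subset_union_left.trans subset_union_right, hC, hC',
    hCD.mono_right subset_union_left, i, i'⟩

end Classes

/-! ### The class of a trim set as a morphism to the structure diagram -/

section ClassMap

variable {W : Type u} {Q : Type v} [TopologicalSpace W] [T2Space W]
  {SQ : POSystem Q} {Y : Q → Set W}

/-- `β q` is the class of all `q`-trim sets, and there are such sets. -/
structure IsClassMap (SQ : POSystem Q) (Y : Q → Set W) (β : Q → SDiagram W) : Prop where
  isOfClass : ∀ {q A}, IsTrimAt SQ Y A q → IsOfClass A (β q)
  exists_trim : ∀ q, ∃ A, IsTrimAt SQ Y A q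

theorem IsCleanFamily.exists_isClassMap [SecondCountableTopology W] (hY : IsCleanFamily SQ Y)
    (hne : ∀ q, (Y q).Nonempty) : ∃ β : Q → SDiagram W, IsClassMap SQ Y β := by
  have h : ∀ q, ∃ A, IsTrimAt SQ Y A q := fun q => by
    obtain ⟨w, hw⟩ := hne q
    obtain ⟨A, hA, -⟩ := hY.clean q w hw
    exact ⟨A, hA⟩
  choose A hA using h
  have hc : ∀ q, IsOfClass (A q) (SDiagram.mk ⟨A q, (hA q).isPISet hY, (hA q).nonempty⟩) :=
    fun q => ⟨_, rfl⟩
  exact ⟨_, ⟨fun {q B} hB => (hc q).congr ((hA q).idealIso hY hB) hB.isKO, fun q => ⟨A q, hA q⟩⟩⟩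

variable {β : Q → SDiagram W} {p : SDiagram W} {A B C : Set W} {q : Q}

theorem IsClassMap.exists_trim_subset (hβ : IsClassMap SQ Y β) (hY : IsCleanFamily SQ Y)
    (hA : IsOfClass A p) : ∃ r, ∃ B ⊆ A, IsTrimAt SQ Y B r ∧ β r = p := by
  obtain ⟨r, B, hBA, hB, i⟩ := hA.isPISet.exists_trim hY hA.nonempty
  exact ⟨r, B, hBA, hB, ((hβ.isOfClass hB).eq_iff hA).2 i⟩

theorem IsClassMap.surjective (hβ : IsClassMap SQ Y β) (hY : IsCleanFamily SQ Y) :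
    Function.Surjective β := fun p => by
  obtain ⟨A, hA⟩ := exists_isOfClass p
  obtain ⟨r, -, -, -, h⟩ := hβ.exists_trim_subset hY hA
  exact ⟨r, h⟩

/-- A set of class `β q` in a `q`-trim set that misses some point of `Y q` yields a larger element
of the same class. -/
theorem IsClassMap.exists_lt_of_notMem (hβ : IsClassMap SQ Y β) (hY : IsCleanFamily SQ Y)
    (hA : IsTrimAt SQ Y A q) (hBA : B ⊆ A) (hB : IsOfClass B p) {y : W} (hy : y ∈ A)
    (hyq : y ∈ Y q) (hyB : y ∉ B) : ∃ r, SQ.lt q r ∧ β r = p := by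
  obtain ⟨r, B', hB', hB'r, hr⟩ := hβ.exists_trim_subset hY hB
  obtain ⟨z, hz, hzr⟩ := hB'r.exists_mem
  refine ⟨r, ?_, hr⟩
  rcases hA.mem_ptype.1 ⟨z, hBA (hB' hz), hzr⟩ with h | rfl
  · exact h
  · exact hA.lt_self hy hyq (hBA (hB' hz)) hzr fun e => hyB (e ▸ hB' hz)

theorem IsClassMap.exists_lt_of_disjoint (hβ : IsClassMap SQ Y β) (hY : IsCleanFamily SQ Y)
    (hA : IsTrimAt SQ Y A q) (hBA : B ⊆ A) (hCA : C ⊆ A) (hB : IsOfClass B p)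
    (hC : IsOfClass C p) (hd : Disjoint B C) : ∃ r, SQ.lt q r ∧ β r = p := by
  obtain ⟨y, hy, hyq⟩ := hA.exists_mem
  by_cases hyB : y ∈ B
  · exact hβ.exists_lt_of_notMem hY hA hCA hC hy hyq (disjoint_left.1 hd hyB)
  · exact hβ.exists_lt_of_notMem hY hA hBA hB hy hyq hyB

theorem IsClassMap.lt (hβ : IsClassMap SQ Y β) (hY : IsCleanFamily SQ Y) {r : Q}
    (h : SQ.lt q r) : (structureDiagram W).lt (β q) (β r) := by
  obtain ⟨A, hA⟩ := hβ.exists_trim q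
  obtain ⟨B, D, hB, hD, hd, rfl⟩ :=
    trimSum_cons.1 (hA.trimSum_cons hY (l := [r]) (by simpa using h))
  obtain ⟨C, E, hC, hE, -, rfl⟩ := trimSum_cons.1 hD
  obtain rfl := trimSum_nil.1 hE
  rw [union_empty] at hd hA
  exact (hβ.isOfClass hB).lt_of_disjoint (hβ.isOfClass hC) hd (hβ.isOfClass hA)

theorem IsClassMap.isMorphism (hβ : IsClassMap SQ Y β) (hY : IsCleanFamily SQ Y) :
    POSystem.IsMorphism SQ (structureDiagram W) β := by
  intro q
  refine Subset.antisymm ?_ fun p hp => ?_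
  · rintro _ ⟨r, hr, rfl⟩
    exact hβ.lt hY hr
  · obtain ⟨A, hA⟩ := hβ.exists_trim q
    obtain ⟨B, C, hB, hC, hd, rfl⟩ := (hβ.isOfClass hA).exists_split hp
    obtain ⟨r, C', hC', hCr, rfl⟩ := hβ.exists_trim_subset hY hC
    rcases hA.mem_ptype.1 (ptype_mono (hC'.trans subset_union_right)
      (hCr.mem_ptype.2 (.inr rfl))) with h | rfl
    · exact ⟨r, h, rfl⟩
    · exact hβ.exists_lt_of_disjoint hY hA subset_union_left subset_union_right hB hC hd

theorem IsClassMap.isSimple [SecondCountableTopology W] (hβ : IsClassMap SQ Y β)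
    (hY : IsCleanFamily SQ Y) : (structureDiagram W).IsSimple := by
  intro R SR δ hδ a b hab
  obtain ⟨q, rfl⟩ := hβ.surjective hY a
  obtain ⟨r, rfl⟩ := hβ.surjective hY b
  have hγ : POSystem.IsMorphism SQ SR (δ ∘ β) := fun q => by
    rw [image_comp, hβ.isMorphism hY q]
    exact hδ (β q)
  obtain ⟨A, hA⟩ := hβ.exists_trim q
  obtain ⟨B, hB⟩ := hβ.exists_trim r
  have hA' := hA.coarsen hγ
  rw [show (δ ∘ β) q = (δ ∘ β) r from hab] at hA'
  exact ((hβ.isOfClass hA).eq_iff (hβ.isOfClass hB)).2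
    (hA'.idealIso (hY.coarsen hγ) (hB.coarsen hγ))

theorem IsClassMap.subset_canonicalBlock (hβ : IsClassMap SQ Y β) (hY : IsCleanFamily SQ Y)
    (q : Q) : Y q ⊆ canonicalBlock (β q) := by
  intro w hw
  rw [mem_canonicalBlock]
  intro U hU
  obtain ⟨A, hA, h⟩ := hY.exists_trim_subset hw hU
  exact ⟨A, hβ.isOfClass hA, h⟩

/-- Sets of class `p` meet the block of `p`. -/
theorem IsClassMap.exists_mem_canonicalBlock (hβ : IsClassMap SQ Y β) (hY : IsCleanFamily SQ Y)
    (hA : IsOfClass A p) : ∃ x ∈ A, x ∈ canonicalBlock p := by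
  obtain ⟨r, B, hBA, hB, rfl⟩ := hβ.exists_trim_subset hY hA
  obtain ⟨x, hx, hxr⟩ := hB.exists_mem
  exact ⟨x, hBA hx, hβ.subset_canonicalBlock hY r hxr⟩

theorem IsClassMap.lt_self_of_ne (hβ : IsClassMap SQ Y β) (hY : IsCleanFamily SQ Y)
    (hA : IsOfClass A p) {x y : W} (hx : x ∈ A) (hy : y ∈ A) (hxp : x ∈ canonicalBlock p)
    (hyp : y ∈ canonicalBlock p) (hxy : x ≠ y) : (structureDiagram W).lt p p := by
  rw [mem_canonicalBlock] at hxp hyp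
  obtain ⟨U, V, hU, hV, hxU, hyV, hUV⟩ := t2_separation hxy
  obtain ⟨B, hB, -, hBU⟩ := hxp (A ∩ U) ((hA.isKO.2.inter hU).mem_nhds ⟨hx, hxU⟩)
  obtain ⟨C, hC, -, hCV⟩ := hyp (A ∩ V) ((hA.isKO.2.inter hV).mem_nhds ⟨hy, hyV⟩)
  obtain ⟨q, rfl⟩ := hβ.surjective hY p
  obtain ⟨A₀, hA₀⟩ := hβ.exists_trim q
  obtain ⟨B₀, hBA, C₀, hCA, kB, kC, hd, i, j⟩ := IdealIso.exists_disjoint_subsets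
    ((hA.eq_iff (hβ.isOfClass hA₀)).1 rfl) hA.isKO hA₀.isKO hB.isKO hC.isKO
    (hBU.trans inter_subset_left) (hCV.trans inter_subset_left)
    (hUV.mono (hBU.trans inter_subset_right) (hCV.trans inter_subset_right))
  obtain ⟨r, hr, hrq⟩ := hβ.exists_lt_of_disjoint hY hA₀ hBA hCA (hB.congr i.symm kB)
    (hC.congr j.symm kC) hd
  have := hβ.lt hY hr
  rwa [hrq] at this

theorem IsClassMap.isPPartition (hβ : IsClassMap SQ Y β) (hY : IsCleanFamily SQ Y) :
    IsPPartition (structureDiagram W) (canonicalBlock (W := W)) := by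
  refine ⟨fun p => ?_, fun p q hpq => canonicalBlock_disjoint hpq, fun p => ?_⟩
  · obtain ⟨A, hA⟩ := exists_isOfClass p
    obtain ⟨x, -, hx⟩ := hβ.exists_mem_canonicalBlock hY hA
    exact ⟨x, hx⟩
  · ext w
    simp only [mem_inter_iff, mem_iUnion, exists_prop]
    constructor
    · rintro ⟨hw, q, hwq⟩
      refine ⟨q, ?_, hwq⟩
      obtain ⟨A, hA, hwA, -⟩ := mem_canonicalBlock.1 hwq univ Filter.univ_mem
      obtain ⟨x, ⟨hxA, hxp⟩, hne⟩ :=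
        accPt_iff_nhds.1 (mem_derivedSet.1 hw) A (hA.isKO.2.mem_nhds hwA)
      obtain ⟨B, hB, -, hBA⟩ := mem_canonicalBlock.1 hxp A (hA.isKO.2.mem_nhds hxA)
      rcases hA.le_of_subset hB hBA with h | rfl
      · exact h
      · exact hβ.lt_self_of_ne hY hA hxA hwA hxp hwq hne
    · rintro ⟨q, hqp, hwq⟩
      refine ⟨mem_derivedSet.2 (accPt_iff_nhds.2 fun U hU => ?_), q, hwq⟩
      obtain ⟨A, hA, hwA, hAU⟩ := mem_canonicalBlock.1 hwq U hU
      have key : ∀ B, IsOfClass B p → B ⊆ A → w ∉ B → ∃ y ∈ U ∩ canonicalBlock p, y ≠ w := by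
        intro B hB hBA hwB
        obtain ⟨x, hxB, hx⟩ := hβ.exists_mem_canonicalBlock hY hB
        exact ⟨x, ⟨hAU (hBA hxB), hx⟩, fun e => hwB (e ▸ hxB)⟩
      obtain ⟨A₁, B₁, hA₁, hB₁, hd, rfl⟩ := hA.exists_split hqp
      by_cases hw : w ∈ B₁
      · obtain ⟨A₂, B₂, -, hB₂, -, rfl⟩ := hA₁.exists_split hqp
        exact key B₂ hB₂ (subset_union_right.trans subset_union_left)
          fun h => disjoint_left.1 hd (.inr h) hw
      · exact key B₁ hB₁ subset_union_right hw

theorem IsClassMap.isTrimAt (hβ : IsClassMap SQ Y β) (hY : IsCleanFamily SQ Y)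
    (hA : IsTrimAt SQ Y A q) : IsTrimAt (structureDiagram W) canonicalBlock A (β q) := by
  have hc := hβ.isOfClass hA
  refine ⟨hA.1, hA.2.1, Subset.antisymm ?_ ?_, fun hq => ?_⟩
  · rintro p ⟨x, hx, hxp⟩
    obtain ⟨B, hB, -, hBA⟩ := mem_canonicalBlock.1 hxp A (hA.isKO.2.mem_nhds hx)
    exact hc.le_of_subset hB hBA
  · rintro p (h | rfl)
    · obtain ⟨r, hr, rfl⟩ := (hβ.isMorphism hY).exists_lt h
      obtain ⟨x, hx, hxr⟩ := hA.mem_ptype.2 (.inl hr)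
      exact ⟨x, hx, hβ.subset_canonicalBlock hY r hxr⟩
    · exact hβ.exists_mem_canonicalBlock hY hc
  · obtain ⟨x, hx, hxq⟩ := hβ.exists_mem_canonicalBlock hY hc
    exact ⟨x, ⟨hx, hxq⟩, fun z hz => by_contra fun hne =>
      hq (hβ.lt_self_of_ne hY hc hz.1 hx hz.2 hxq hne)⟩

theorem IsClassMap.hasTrimBases (hβ : IsClassMap SQ Y β) (hY : IsCleanFamily SQ Y) :
    HasTrimBases (structureDiagram W) (canonicalBlock (W := W)) := fun w U hU => by
  obtain ⟨A, ⟨q, hA⟩, h⟩ := hY.bases w U hU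
  exact ⟨A, ⟨β q, hβ.isTrimAt hY hA⟩, h⟩

theorem IsClassMap.regRefines (hβ : IsClassMap SQ Y β) (hY : IsCleanFamily SQ Y)
    (hP : IsPPartition SQ Y) : RegRefines SQ (structureDiagram W) Y canonicalBlock β := by
  refine ⟨⟨hP, hY.bases⟩, ⟨hβ.isPPartition hY, hβ.hasTrimBases hY⟩,
    hβ.subset_canonicalBlock hY, fun p _ A hA => ?_⟩
  obtain ⟨x, hx, hxp⟩ := hA.exists_mem
  obtain ⟨B, hB, -, hBA⟩ := mem_canonicalBlock.1 hxp A (hA.isKO.2.mem_nhds hx)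
  obtain ⟨r, C, hCB, hC, rfl⟩ := hβ.exists_trim_subset hY hB
  exact ⟨r, ptype_mono (hCB.trans hBA) (hC.mem_ptype.2 (.inr rfl)), rfl⟩

end ClassMap

/-- A trim `Q`-partition of a primitive space regularly refines the canonical partition via the
unique surjective morphism `β : Q → 𝒮(W)`, and `𝒮(W)` is the simple image of `Q`: it is a simple
image of `Q`, and every simple image of `Q` is isomorphic to it. -/
theorem regRefines_canonical {W : Type u} {Q : Type v}
    [TopologicalSpace W] [SecondCountableTopology W] [LocallyCompactSpace W]
    [T2Space W] [TotallyDisconnectedSpace W] (hW : PrimitiveSpace W)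
    (SQ : POSystem Q) (Y : Q → Set W) (hY : IsTrimPartition SQ Y) :
    (∃ β : Q → SDiagram W,
      Function.Surjective β ∧ POSystem.IsMorphism SQ (structureDiagram W) β ∧
      RegRefines SQ (structureDiagram W) Y canonicalBlock β ∧
      ∀ β' : Q → SDiagram W, Function.Surjective β' →
        POSystem.IsMorphism SQ (structureDiagram W) β' → β' = β) ∧
    POSystem.IsSimpleImage SQ (structureDiagram W) ∧
    ∀ (T : Type w) (ST : POSystem T), POSystem.IsSimpleImage SQ ST →
      ∃ φ : SDiagram W → T, POSystem.IsIso (structureDiagram W) ST φ := by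
  have hX := hY.isCleanFamily
  obtain ⟨β, hβ⟩ := hX.exists_isClassMap hY.1.1
  have hsimple := hβ.isSimple hX
  have hmor := hβ.isMorphism hX
  have himage : POSystem.IsSimpleImage SQ (structureDiagram W) :=
    ⟨hsimple, β, hβ.surjective hX, hmor⟩
  exact ⟨⟨β, hβ.surjective hX, hmor, hβ.regRefines hX hY.1,
    fun _ _ h => hsimple.morphism_unique h hmor⟩, himage, fun _ _ h => himage.exists_isIso h⟩
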